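/- Let d be a positive integer and let a_1 < b_1 < a_2 < b_2 < a_3 < b_3 < ⋯ be an increasing sequence of natural numbers with b_k > k² a_k for all k ≥ 1. Then there exist a compact metric space (𝒳, 𝐝), a continuous action T : ℝ^d × 𝒳 → 𝒳, and an invariant measure ν ∈ M^T(𝒳) satisfying: (i) the upper metric mean dimension umdim_M(𝒳,T,𝐝) is finite; (ii) urdim(𝒳,T,𝐝,ν) = 1; and (iii) R(𝐝, ν, 2^{−t})/t → 0 as t → ∞ subject to t ∈ ⋃_{k≥1} [b_k, a_{k+1}). -/

import Mathlib

open MeasureTheory Filter Set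
open scoped ENNReal Topology NNReal

noncomputable section

/-- Shannon entropy (base 2) of a finitely-valued random variable. -/
def shannonEntropy {Ω S : Type*} [MeasurableSpace Ω] [Fintype S]
    (P : Measure Ω) (f : Ω → S) : ℝ :=
  -∑ i : S, ((P (f ⁻¹' {i})).toReal * Real.logb 2 ((P (f ⁻¹' {i})).toReal))

/-- Mutual information (base 2) of two random variables, defined as the supremum over all
finite measurable partitions (encoded as measurable maps into `Fin n`) of
`H(α∘X) + H(β∘Y) - H(α∘X, β∘Y)`. -/
def mutualInfo {Ω A B : Type*} [MeasurableSpace Ω] [MeasurableSpace A] [MeasurableSpace B]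
    (P : Measure Ω) (X : Ω → A) (Y : Ω → B) : ℝ≥0∞ :=
  ⨆ (n : ℕ) (m : ℕ) (α : A → Fin n) (_ : Measurable α) (β : B → Fin m) (_ : Measurable β),
    ENNReal.ofReal (shannonEntropy P (fun ω => α (X ω)) + shannonEntropy P (fun ω => β (Y ω))
      - shannonEntropy P (fun ω => (α (X ω), β (Y ω))))

/-- The box `[0,L)^d ⊆ ℝ^d`. -/
def unitBox (d : ℕ) (L : ℝ) : Set (Fin d → ℝ) := Set.univ.pi fun _ => Set.Ico (0 : ℝ) L

/-- Lebesgue measure on `ℝ^d` restricted to the box `[0,L)^d`. -/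
def boxMeasure (d : ℕ) (L : ℝ) : Measure (Fin d → ℝ) := volume.restrict (unitBox d L)

/-- The space `L¹([0,L)^d, X)` of measurable maps modulo a.e. equality. -/
abbrev L1Maps (d : ℕ) (L : ℝ) (X : Type*) [TopologicalSpace X] :=
  (Fin d → ℝ) →ₘ[boxMeasure d L] X

/-- The `L¹` distance `D(f,g) = ∫_{[0,L)^d} 𝐝(f(u), g(u)) dm(u)`. -/
def L1dist {d : ℕ} {L : ℝ} {X : Type*} [MetricSpace X] (f g : L1Maps d L X) : ℝ :=
  ∫ u, dist (f u) (g u) ∂(boxMeasure d L)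

/-- The Borel σ-algebra of the metric `L1dist` on `L¹([0,L)^d, X)`,
generated by the open balls of the metric. -/
instance L1Maps.measurableSpace {d : ℕ} {L : ℝ} {X : Type*} [MetricSpace X] :
    MeasurableSpace (L1Maps d L X) :=
  MeasurableSpace.generateFrom {s | ∃ (f : L1Maps d L X) (r : ℝ), s = {g | L1dist f g < r}}

/-- The expected mean distortion `E[(1/L^d) ∫_{[0,L)^d} 𝐝(T^u X, Y_u) dm(u)]`. -/
def distortion {X : Type*} [MetricSpace X] (d : ℕ) (T : (Fin d → ℝ) → X → X) (L : ℝ)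
    {Ω : Type*} [MeasurableSpace Ω] (P : Measure Ω) (Xv : Ω → X) (Yv : Ω → L1Maps d L X) : ℝ :=
  ∫ ω, (L ^ d)⁻¹ * ∫ u, dist (T u (Xv ω)) (Yv ω u) ∂(boxMeasure d L) ∂P

/-- `R_L(𝐝, μ, ε)`: the infimum of `I(X;Y)` over all pairs of random variables on a common
probability space with `Law X = μ`, `Y` taking values in `L¹([0,L)^d, X)` and expected mean
distortion `< ε`. -/
def RL {X : Type*} [MetricSpace X] [MeasurableSpace X] (d : ℕ)
    (T : (Fin d → ℝ) → X → X) (μ : Measure X) (L ε : ℝ) : ℝ≥0∞ :=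
  ⨅ (Ω : Type) (_ : MeasurableSpace Ω) (P : Measure Ω) (_ : IsProbabilityMeasure P)
    (Xv : Ω → X) (Yv : Ω → L1Maps d L X) (_ : Measurable Xv) (_ : Measurable Yv)
    (_ : Measure.map Xv P = μ) (_ : distortion d T L P Xv Yv < ε),
    mutualInfo P Xv Yv

/-- The rate distortion function `R(𝐝, μ, ε) = lim_{L→∞} R_L(𝐝, μ, ε)/L^d`, which exists and
equals `inf_{L>0} R_L(𝐝, μ, ε)/L^d`. -/
def RD {X : Type*} [MetricSpace X] [MeasurableSpace X] (d : ℕ)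
    (T : (Fin d → ℝ) → X → X) (μ : Measure X) (ε : ℝ) : ℝ≥0∞ :=
  ⨅ (L : ℝ) (_ : 0 < L), RL d T μ L ε / ENNReal.ofReal (L ^ d)

/-- Upper rate distortion dimension. -/
def urdim {X : Type*} [MetricSpace X] [MeasurableSpace X] (d : ℕ)
    (T : (Fin d → ℝ) → X → X) (μ : Measure X) : ℝ≥0∞ :=
  Filter.limsup (fun ε : ℝ => RD d T μ ε / ENNReal.ofReal (Real.logb 2 (1 / ε))) (𝓝[>] (0 : ℝ))

/-- Lower rate distortion dimension. -/
def lrdim {X : Type*} [MetricSpace X] [MeasurableSpace X] (d : ℕ)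
    (T : (Fin d → ℝ) → X → X) (μ : Measure X) : ℝ≥0∞ :=
  Filter.liminf (fun ε : ℝ => RD d T μ ε / ENNReal.ofReal (Real.logb 2 (1 / ε))) (𝓝[>] (0 : ℝ))

/-- `μ` is invariant under the `ℝ^d`-action `T`. -/
def MeasInvariant {X : Type*} [MeasurableSpace X] (d : ℕ)
    (T : (Fin d → ℝ) → X → X) (μ : Measure X) : Prop :=
  ∀ u : Fin d → ℝ, Measure.map (T u) μ = μ

/-- `T` is a continuous action of the additive group `ℝ^d`. -/
def IsContAction {X : Type*} [TopologicalSpace X] (d : ℕ) (T : (Fin d → ℝ) → X → X) : Prop :=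
  Continuous (fun p : (Fin d → ℝ) × X => T p.1 p.2) ∧ (∀ x, T 0 x = x) ∧
    ∀ u v x, T (u + v) x = T u (T v x)

/-- The metric `𝐝_L(x,y) = sup_{u ∈ [0,L)^d} 𝐝(T^u x, T^u y)`. -/
def dSup {X : Type*} [MetricSpace X] (d : ℕ) (T : (Fin d → ℝ) → X → X) (L : ℝ) (x y : X) : ℝ :=
  ⨆ u : unitBox d L, dist (T u.1 x) (T u.1 y)

/-- The `ε`-covering number of `X` for the (pre)metric `ρ`: the minimal number of open sets
of `ρ`-diameter `< ε` covering `X`. -/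
def covNum (X : Type*) [TopologicalSpace X] (ρ : X → X → ℝ) (ε : ℝ) : ℕ :=
  sInf {n : ℕ | ∃ F : Finset (Set X), F.card = n ∧
    (∀ U ∈ F, IsOpen U ∧ (⨆ x ∈ U, ⨆ y ∈ U, ENNReal.ofReal (ρ x y)) < ENNReal.ofReal ε) ∧
    ⋃₀ (F : Set (Set X)) = Set.univ}

/-- The entropy at scale `ε`: `S(X,T,𝐝,ε) = lim_{L→∞} log₂ #(X, 𝐝_L, ε) / L^d`
(the limit exists, hence equals the limsup used here). -/
def entScale {X : Type*} [MetricSpace X] (d : ℕ) (T : (Fin d → ℝ) → X → X) (ε : ℝ) : ℝ≥0∞ :=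
  Filter.limsup
    (fun L : ℝ => ENNReal.ofReal (Real.logb 2 (covNum X (dSup d T L) ε) / L ^ d)) Filter.atTop

/-- The upper metric mean dimension. -/
def umdim {X : Type*} [MetricSpace X] (d : ℕ) (T : (Fin d → ℝ) → X → X) : ℝ≥0∞ :=
  Filter.limsup (fun ε : ℝ => entScale d T ε / ENNReal.ofReal (Real.logb 2 (1 / ε))) (𝓝[>] (0 : ℝ))

/-- The σ-algebra on the space of Borel probability measures on `X` (for a compact metric `X`
this is the Borel σ-algebra of the weak* topology). -/
instance ProbabilityMeasure.measurableSpace' {α : Type*} [MeasurableSpace α] :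
    MeasurableSpace (ProbabilityMeasure α) :=
  inferInstanceAs (MeasurableSpace {μ : Measure α // IsProbabilityMeasure μ})

/-- The space `M^T(X)` of `T`-invariant Borel probability measures on `X`. -/
abbrev InvM (X : Type*) [MeasurableSpace X] [MetricSpace X] (d : ℕ)
    (T : (Fin d → ℝ) → X → X) :=
  {ν : ProbabilityMeasure X // MeasInvariant d T (ν : Measure X)}

end

open MeasureTheory Filter Set
open scoped ENNReal Topology NNReal

namespace RDExample

/-- Elementary inequality behind all the entropy estimates. -/
lemma dv_term {p r q G : ℝ} (hp : 0 ≤ p) (hr : p ≤ r) (hq : p ≤ q) (hG : 0 < G) :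
    (p - r * q * G) / Real.log 2 ≤
      p * (Real.logb 2 p - Real.logb 2 r - Real.logb 2 q - Real.logb 2 G) := by
  have h2 : 0 < Real.log 2 := Real.log_pos (by norm_num)
  rcases hp.eq_or_lt with h0 | h0
  · subst h0
    have : 0 ≤ r * q * G := by positivity
    rw [zero_mul]
    exact div_nonpos_of_nonpos_of_nonneg (by linarith) h2.le
  · have hr0 : 0 < r := h0.trans_le hr
    have hq0 : 0 < q := h0.trans_le hq
    have key := Real.log_le_sub_one_of_pos (x := r * q * G / p) (by positivity)
    rw [Real.log_div (by positivity) (by positivity), Real.log_mul (by positivity) (by positivity),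
      Real.log_mul (by positivity) (by positivity)] at key
    have : p * (Real.logb 2 p - Real.logb 2 r - Real.logb 2 q - Real.logb 2 G)
        = (p * (Real.log p - Real.log r - Real.log q - Real.log G)) / Real.log 2 := by
      simp only [Real.logb]; field_simp
    rw [this]
    gcongr
    have h3 : p * (r * q * G / p - 1) = r * q * G - p := by field_simp
    nlinarith

section entropy
variable {Ω S S' : Type*} [MeasurableSpace Ω] [Fintype S] [Fintype S']
  [MeasurableSpace S] [MeasurableSpace S'] [MeasurableSingletonClass S]
  [MeasurableSingletonClass S']

set_option linter.unusedSectionVars false in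
lemma marg_fst (P : Measure Ω) [IsProbabilityMeasure P] {f : Ω → S} {g : Ω → S'}
    (hf : Measurable f) (hg : Measurable g) (i : S) :
    (P (f ⁻¹' {i})).toReal = ∑ j : S', (P ((fun ω => (f ω, g ω)) ⁻¹' {(i, j)})).toReal := by
  classical
  rw [← ENNReal.toReal_sum (fun _ _ => measure_ne_top _ _)]
  congr 1
  rw [← measure_biUnion_finset]
  · congr 1; ext ω; simp
  · intro a _ b _ hab
    refine Set.disjoint_left.2 fun ω h1 h2 => hab ?_
    simp at h1 h2
    exact h1.2.symm.trans h2.2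
  · intro j _
    have : (fun ω => (f ω, g ω)) ⁻¹' {(i, j)} = f ⁻¹' {i} ∩ g ⁻¹' {j} := by
      ext ω; simp
    rw [this]
    exact (hf (measurableSet_singleton i)).inter (hg (measurableSet_singleton j))

lemma marg_snd (P : Measure Ω) [IsProbabilityMeasure P] {f : Ω → S} {g : Ω → S'}
    (hf : Measurable f) (hg : Measurable g) (j : S') :
    (P (g ⁻¹' {j})).toReal = ∑ i : S, (P ((fun ω => (f ω, g ω)) ⁻¹' {(i, j)})).toReal := by
  rw [marg_fst P hg hf j]
  refine Finset.sum_congr rfl fun i _ => ?_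
  congr 2; ext ω; simp [and_comm]

lemma sum_prob (P : Measure Ω) [IsProbabilityMeasure P] {f : Ω → S} (hf : Measurable f) :
    ∑ i : S, (P (f ⁻¹' {i})).toReal = 1 := by
  rw [← ENNReal.toReal_sum (fun _ _ => measure_ne_top _ _), ← measure_biUnion_finset]
  · have : (⋃ b ∈ (Finset.univ : Finset S), f ⁻¹' {b}) = Set.univ := by ext; simp
    rw [this]; simp
  · intro a _ b _ hab
    refine Set.disjoint_left.2 fun ω h1 h2 => hab ?_
    simp at h1 h2
    exact h1.symm.trans h2
  · intro j _
    exact hf (measurableSet_singleton j)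

lemma prob_le_one (P : Measure Ω) [IsProbabilityMeasure P] (s : Set Ω) : (P s).toReal ≤ 1 := by
  exact ENNReal.toReal_le_of_le_ofReal zero_le_one (by simpa using MeasureTheory.prob_le_one)

lemma mi_eq (P : Measure Ω) [IsProbabilityMeasure P] {f : Ω → S} {g : Ω → S'}
    (hf : Measurable f) (hg : Measurable g) :
    shannonEntropy P f + shannonEntropy P g - shannonEntropy P (fun ω => (f ω, g ω))
      = ∑ i : S, ∑ j : S', (P ((fun ω => (f ω, g ω)) ⁻¹' {(i, j)})).toReal *
        (Real.logb 2 (P ((fun ω => (f ω, g ω)) ⁻¹' {(i, j)})).toReal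
          - Real.logb 2 (P (f ⁻¹' {i})).toReal - Real.logb 2 (P (g ⁻¹' {j})).toReal) := by
  have h1 : shannonEntropy P f = -∑ i : S, ∑ j : S',
      (P ((fun ω => (f ω, g ω)) ⁻¹' {(i, j)})).toReal * Real.logb 2 (P (f ⁻¹' {i})).toReal := by
    unfold shannonEntropy
    congr 1
    refine Finset.sum_congr rfl fun i _ => ?_
    rw [← Finset.sum_mul, ← marg_fst P hf hg i]
  have h2 : shannonEntropy P g = -∑ i : S, ∑ j : S',
      (P ((fun ω => (f ω, g ω)) ⁻¹' {(i, j)})).toReal * Real.logb 2 (P (g ⁻¹' {j})).toReal := by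
    unfold shannonEntropy
    rw [Finset.sum_comm]
    congr 1
    refine Finset.sum_congr rfl fun j _ => ?_
    rw [← Finset.sum_mul, ← marg_snd P hf hg j]
  have h3 : shannonEntropy P (fun ω => (f ω, g ω)) = -∑ i : S, ∑ j : S',
      (P ((fun ω => (f ω, g ω)) ⁻¹' {(i, j)})).toReal *
        Real.logb 2 (P ((fun ω => (f ω, g ω)) ⁻¹' {(i, j)})).toReal := by
    unfold shannonEntropy
    rw [Fintype.sum_prod_type]
  rw [h1, h2, h3]
  simp only [mul_sub, Finset.sum_sub_distrib]
  ring

/-- Finite Donsker–Varadhan bound. -/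
lemma mi_lower (P : Measure Ω) [IsProbabilityMeasure P] {f : Ω → S} {g : Ω → S'}
    (hf : Measurable f) (hg : Measurable g) (G : S → S' → ℝ) (hG : ∀ i j, 0 < G i j)
    (hG1 : ∀ j, ∑ i, (P (f ⁻¹' {i})).toReal * G i j ≤ 1) :
    ∑ i : S, ∑ j : S', (P ((fun ω => (f ω, g ω)) ⁻¹' {(i, j)})).toReal * Real.logb 2 (G i j) ≤
    shannonEntropy P f + shannonEntropy P g - shannonEntropy P (fun ω => (f ω, g ω)) := by
  rw [mi_eq P hf hg, ← sub_nonneg, ← Finset.sum_sub_distrib]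
  simp_rw [← Finset.sum_sub_distrib, ← mul_sub]
  have h2 : 0 < Real.log 2 := Real.log_pos (by norm_num)
  have hle : ∀ i j, ((P ((fun ω => (f ω, g ω)) ⁻¹' {(i, j)})).toReal -
      (P (f ⁻¹' {i})).toReal * (P (g ⁻¹' {j})).toReal * G i j) / Real.log 2 ≤
      (P ((fun ω => (f ω, g ω)) ⁻¹' {(i, j)})).toReal *
        (Real.logb 2 (P ((fun ω => (f ω, g ω)) ⁻¹' {(i, j)})).toReal
          - Real.logb 2 (P (f ⁻¹' {i})).toReal - Real.logb 2 (P (g ⁻¹' {j})).toReal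
          - Real.logb 2 (G i j)) := by
    intro i j
    apply dv_term ENNReal.toReal_nonneg _ _ (hG i j)
    · exact ENNReal.toReal_mono (measure_ne_top _ _) (measure_mono (by intro ω; simp; tauto))
    · exact ENNReal.toReal_mono (measure_ne_top _ _) (measure_mono (by intro ω; simp))
  refine le_trans ?_ (Finset.sum_le_sum fun i _ => Finset.sum_le_sum fun j _ => hle i j)
  simp_rw [← Finset.sum_div, Finset.sum_sub_distrib]
  refine div_nonneg ?_ h2.le
  have e1 : ∑ i : S, ∑ j : S', (P ((fun ω => (f ω, g ω)) ⁻¹' {(i, j)})).toReal = 1 := by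
    simp_rw [← marg_fst P hf hg]; exact sum_prob P hf
  have e2 : ∑ i : S, ∑ j : S', (P (f ⁻¹' {i})).toReal * (P (g ⁻¹' {j})).toReal * G i j ≤ 1 := by
    rw [Finset.sum_comm, ← sum_prob P hg]
    refine Finset.sum_le_sum fun j _ => ?_
    calc ∑ i, (P (f ⁻¹' {i})).toReal * (P (g ⁻¹' {j})).toReal * G i j
        = (P (g ⁻¹' {j})).toReal * ∑ i, (P (f ⁻¹' {i})).toReal * G i j := by
          rw [Finset.mul_sum]; exact Finset.sum_congr rfl fun i _ => by ring
      _ ≤ (P (g ⁻¹' {j})).toReal * 1 := by gcongr; exact hG1 j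
      _ = _ := mul_one _
  linarith

lemma mi_le_entropy (P : Measure Ω) [IsProbabilityMeasure P] {f : Ω → S} {g : Ω → S'}
    (hf : Measurable f) (hg : Measurable g) :
    shannonEntropy P f + shannonEntropy P g - shannonEntropy P (fun ω => (f ω, g ω))
      ≤ shannonEntropy P g := by
  rw [mi_eq P hf hg]
  have h2 : shannonEntropy P g = -∑ i : S, ∑ j : S',
      (P ((fun ω => (f ω, g ω)) ⁻¹' {(i, j)})).toReal * Real.logb 2 (P (g ⁻¹' {j})).toReal := by
    unfold shannonEntropy
    rw [Finset.sum_comm]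
    congr 1
    refine Finset.sum_congr rfl fun j _ => ?_
    rw [← Finset.sum_mul, ← marg_snd P hf hg j]
  rw [h2, ← Finset.sum_neg_distrib]
  refine Finset.sum_le_sum fun i _ => ?_
  rw [← Finset.sum_neg_distrib]
  refine Finset.sum_le_sum fun j _ => ?_
  set p := (P ((fun ω => (f ω, g ω)) ⁻¹' {(i, j)})).toReal with hp
  have hpr : p ≤ (P (f ⁻¹' {i})).toReal :=
    ENNReal.toReal_mono (measure_ne_top _ _) (measure_mono (by intro ω; simp; tauto))
  have hp0 : 0 ≤ p := ENNReal.toReal_nonneg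
  rcases hp0.eq_or_lt with h0 | h0
  · rw [← h0]; simp
  · have : Real.logb 2 p ≤ Real.logb 2 (P (f ⁻¹' {i})).toReal :=
      Real.logb_le_logb_of_le (by norm_num) h0 hpr
    nlinarith

/-- Entropy is at most the logarithm of the number of values. -/
lemma entropy_le (P : Measure Ω) [IsProbabilityMeasure P] {ι : Type*} [Fintype ι] {g : Ω → S'}
    (hg : Measurable g) (κ : Ω → ι) (γ : ι → S') (hγ : ∀ ω, g ω = γ (κ ω)) :
    shannonEntropy P g ≤ Real.logb 2 (Fintype.card ι) := by
  classical
  have h2 : 0 < Real.log 2 := Real.log_pos (by norm_num)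
  set F : Finset S' := Finset.univ.image γ with hF
  have hne : Nonempty Ω := by
    by_contra h
    rw [not_nonempty_iff] at h
    have := measure_univ (μ := P)
    simp [Set.univ_eq_empty_iff.2 h] at this
  have hFc : 0 < F.card := Finset.card_pos.2 ⟨γ (κ hne.some), by simp [hF]⟩
  have hzero : ∀ i ∉ F, (P (g ⁻¹' {i})).toReal = 0 := by
    intro i hi
    have : g ⁻¹' {i} = ∅ := by
      ext ω
      simp only [mem_preimage, mem_singleton_iff, mem_empty_iff_false, iff_false]
      intro h
      exact hi (by rw [← h, hγ]; simp [hF])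
    rw [this]; simp
  have hsum : ∑ i ∈ F, (P (g ⁻¹' {i})).toReal = 1 := by
    rw [← sum_prob P hg]
    exact Finset.sum_subset (Finset.subset_univ _) fun i _ hi => hzero i hi
  have hcard : (F.card : ℝ) ≤ Fintype.card ι := by
    exact_mod_cast Finset.card_image_le
  refine le_trans ?_ (Real.logb_le_logb_of_le (by norm_num) (by exact_mod_cast hFc) hcard)
  have hs : shannonEntropy P g = -∑ i ∈ F, (P (g ⁻¹' {i})).toReal *
      Real.logb 2 (P (g ⁻¹' {i})).toReal := by
    unfold shannonEntropy
    congr 1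
    symm
    exact Finset.sum_subset (Finset.subset_univ _) fun i _ hi => by rw [hzero i hi]; simp
  have hM : (0 : ℝ) < F.card := by exact_mod_cast hFc
  have key : ∑ i ∈ F, ((P (g ⁻¹' {i})).toReal - 1 * 1 * (F.card : ℝ)⁻¹) / Real.log 2 ≤
      ∑ i ∈ F, (P (g ⁻¹' {i})).toReal * (Real.logb 2 (P (g ⁻¹' {i})).toReal - Real.logb 2 1
        - Real.logb 2 1 - Real.logb 2 (F.card : ℝ)⁻¹) :=
    Finset.sum_le_sum fun i _ => dv_term ENNReal.toReal_nonneg (prob_le_one P _)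
      (prob_le_one P _) (by positivity)
  rw [← Finset.sum_div, Finset.sum_sub_distrib, hsum] at key
  simp only [Real.logb_one, sub_zero, Real.logb_inv, sub_neg_eq_add, mul_add,
    Finset.sum_add_distrib, ← Finset.sum_mul, hsum, Finset.sum_const, nsmul_eq_mul] at key
  simp only [mul_one, one_mul, mul_inv_cancel₀ hM.ne'] at key
  rw [hs]
  simp only [sub_self, zero_div] at key
  linarith

end entropy

lemma mutualInfo_le {Ω A B : Type*} [MeasurableSpace Ω] [MeasurableSpace A] [MeasurableSpace B]
    (P : Measure Ω) [IsProbabilityMeasure P] (X : Ω → A) (hX : Measurable X) {ι : Type*}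
    [Fintype ι] (κ : Ω → ι) (r : ι → B) (hY : Measurable fun ω => r (κ ω)) :
    mutualInfo P X (fun ω => r (κ ω)) ≤ ENNReal.ofReal (Real.logb 2 (Fintype.card ι)) := by
  unfold mutualInfo
  refine iSup_le fun n => iSup_le fun m => iSup_le fun α => iSup_le fun hα => iSup_le fun β =>
    iSup_le fun hβ => ENNReal.ofReal_le_ofReal ?_
  exact (mi_le_entropy P (hα.comp hX) (hβ.comp hY)).trans
    (entropy_le P (hβ.comp hY) κ (fun i => β (r i)) fun _ => rfl)

lemma integral_comp_fintype {Ω S : Type*} [MeasurableSpace Ω] [Fintype S] [MeasurableSpace S]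
    [MeasurableSingletonClass S] (P : Measure Ω) [IsProbabilityMeasure P] {f : Ω → S}
    (hf : Measurable f) (φ : S → ℝ) :
    ∫ ω, φ (f ω) ∂P = ∑ i, (P (f ⁻¹' {i})).toReal * φ i := by
  have := Measure.isProbabilityMeasure_map (μ := P) hf.aemeasurable
  have hφ : Measurable φ := measurable_of_finite φ
  rw [← integral_map hf.aemeasurable hφ.aestronglyMeasurable, integral_fintype .of_finite]
  refine Finset.sum_congr rfl fun i _ => ?_
  rw [measureReal_def, Measure.map_apply hf (measurableSet_singleton i), smul_eq_mul]

/-- Donsker–Varadhan lower bound for the mutual information. -/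
lemma le_mutualInfo {Ω A B : Type*} [MeasurableSpace Ω] [MeasurableSpace A] [MeasurableSpace B]
    (P : Measure Ω) [IsProbabilityMeasure P] (X : Ω → A) (hX : Measurable X) (Y : Ω → B)
    (hY : Measurable Y) {m : ℕ} (β : B → Fin m) (hβ : Measurable β) (k : A → Fin m → ℝ)
    (hk : ∀ j, Measurable fun x => k x j) (C : ℝ) (hC : ∀ x j, |k x j| ≤ C)
    (hint : ∀ j, ∫ ω, (2 : ℝ) ^ (k (X ω) j) ∂P ≤ 1) :
    ENNReal.ofReal (∫ ω, k (X ω) (β (Y ω)) ∂P) ≤ mutualInfo P X Y := by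
  classical
  refine ENNReal.le_of_forall_pos_le_add fun η hη _ => ?_
  have hη' : (0 : ℝ) < η := hη
  -- quantization
  obtain ⟨c, hc⟩ := exists_nat_gt (C / η + 1)
  set I := Set.Icc (-(c : ℤ)) c
  have hfl : ∀ x j, ⌊k x j / η⌋ ∈ I := by
    intro x j
    have h := abs_le.1 (hC x j)
    have h1 : -(C / η) ≤ k x j / η := by rw [← neg_div]; gcongr; exact h.1
    have h2 : k x j / η ≤ C / η := by gcongr; exact h.2
    constructor
    · rw [Int.le_floor]; push_cast; linarith
    · have := Int.floor_le (k x j / η)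
      have h3 : (⌊k x j / η⌋ : ℝ) ≤ ((c : ℤ) : ℝ) := by push_cast; linarith
      exact_mod_cast h3
  let a : A → (Fin m → I) := fun x j => ⟨⌊k x j / η⌋, hfl x j⟩
  have ha : Measurable a := by
    refine measurable_pi_lambda _ fun j => Measurable.subtype_mk ?_
    exact Int.measurable_floor.comp ((hk j).div_const _)
  let e := Fintype.equivFin (Fin m → I)
  have he : Measurable e := measurable_of_finite _
  let α : A → Fin (Fintype.card (Fin m → I)) := fun x => e (a x)
  have hα : Measurable α := he.comp ha
  let G : Fin (Fintype.card (Fin m → I)) → Fin m → ℝ := fun i j => 2 ^ ((η : ℝ) * (e.symm i j : ℤ))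
  have hG : ∀ i j, 0 < G i j := fun i j => by positivity
  have hGa : ∀ x j, G (α x) j = 2 ^ ((η : ℝ) * ⌊k x j / η⌋) := by
    intro x j; simp [G, α, a]
  have hup : ∀ x j, (η : ℝ) * ⌊k x j / η⌋ ≤ k x j := by
    intro x j
    have := Int.floor_le (k x j / η)
    rwa [le_div_iff₀' hη'] at this
  have hlow : ∀ x j, k x j - η ≤ (η : ℝ) * ⌊k x j / η⌋ := by
    intro x j
    have := Int.sub_one_lt_floor (k x j / η)
    have h4 : (η : ℝ) * (k x j / η - 1) = k x j - η := by field_simp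
    nlinarith
  have hkint : ∀ j, Integrable (fun ω => (2 : ℝ) ^ (k (X ω) j)) P := by
    intro j
    refine Integrable.of_bound (C := 2 ^ C) ?_ (ae_of_all _ fun ω => ?_)
    · exact (((hk j).comp hX).const_pow 2).aestronglyMeasurable
    · rw [Real.norm_of_nonneg (by positivity)]
      exact Real.rpow_le_rpow_of_exponent_le (by norm_num) (abs_le.1 (hC _ _)).2
  have h1 := mi_lower P (hα.comp hX) (hβ.comp hY) G hG (by
    intro j
    rw [← integral_comp_fintype P (hα.comp hX) (fun i => G i j)]
    refine le_trans (integral_mono_of_nonneg (ae_of_all _ fun ω => (hG _ _).le) (hkint j)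
      (ae_of_all _ fun ω => ?_)) (hint j)
    simp only [Function.comp_apply, hGa]
    exact Real.rpow_le_rpow_of_exponent_le (by norm_num) (hup _ _))
  have h2 : ∫ ω, k (X ω) (β (Y ω)) ∂P - η ≤ ∑ i, ∑ j,
      (P ((fun ω => ((α ∘ X) ω, (β ∘ Y) ω)) ⁻¹' {(i, j)})).toReal * Real.logb 2 (G i j) := by
    have h3 := integral_comp_fintype P (f := fun ω => ((α ∘ X) ω, (β ∘ Y) ω))
      ((hα.comp hX).prodMk (hβ.comp hY)) (fun p => Real.logb 2 (G p.1 p.2))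
    rw [Fintype.sum_prod_type] at h3
    rw [← h3]
    have hm : Measurable fun ω => k (X ω) (β (Y ω)) := by
      have : Measurable (fun p : A × Fin m => k p.1 p.2) :=
        measurable_from_prod_countable_left fun j => hk j
      exact this.comp (hX.prodMk (hβ.comp hY))
    have hi : Integrable (fun ω => k (X ω) (β (Y ω))) P :=
      Integrable.of_bound (C := C) hm.aestronglyMeasurable
        (ae_of_all _ fun ω => by simpa using hC _ _)
    have : ∫ ω, k (X ω) (β (Y ω)) ∂P - η = ∫ ω, (k (X ω) (β (Y ω)) - η) ∂P := by
      rw [integral_sub hi (integrable_const _)]; simp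
    rw [this]
    refine integral_mono (hi.sub (integrable_const _)) ?_ fun ω => ?_
    · have hb : Measurable fun p : Fin (Fintype.card (Fin m → I)) × Fin m =>
          Real.logb 2 (G p.1 p.2) := measurable_of_finite _
      obtain ⟨D, hD⟩ : ∃ D, ∀ p : Fin (Fintype.card (Fin m → I)) × Fin m,
          |Real.logb 2 (G p.1 p.2)| ≤ D := by
        obtain ⟨D, hD⟩ := (Set.finite_range fun p : Fin (Fintype.card (Fin m → I)) × Fin m =>
          |Real.logb 2 (G p.1 p.2)|).bddAbove
        exact ⟨D, fun p => hD ⟨p, rfl⟩⟩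
      exact Integrable.of_bound (C := D)
        (hb.comp ((hα.comp hX).prodMk (hβ.comp hY))).aestronglyMeasurable
        (ae_of_all _ fun ω => hD _)
    · simp only [Function.comp_apply, hGa]
      rw [Real.logb_rpow (by norm_num) (by norm_num)]
      exact hlow _ _
  calc ENNReal.ofReal (∫ ω, k (X ω) (β (Y ω)) ∂P)
      ≤ ENNReal.ofReal ((shannonEntropy P (α ∘ X) + shannonEntropy P (β ∘ Y)
        - shannonEntropy P (fun ω => ((α ∘ X) ω, (β ∘ Y) ω))) + η) :=
        ENNReal.ofReal_le_ofReal (by linarith)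
    _ ≤ ENNReal.ofReal (shannonEntropy P (α ∘ X) + shannonEntropy P (β ∘ Y)
        - shannonEntropy P (fun ω => ((α ∘ X) ω, (β ∘ Y) ω))) + η := by
        refine ENNReal.ofReal_add_le.trans ?_
        simp
    _ ≤ mutualInfo P X Y + η := by
        gcongr
        unfold mutualInfo
        exact le_iSup_of_le _ (le_iSup_of_le _ (le_iSup_of_le α (le_iSup_of_le hα
          (le_iSup_of_le β (le_iSup_of_le hβ le_rfl)))))

end RDExample

open MeasureTheory Filter Set
open scoped ENNReal Topology NNReal

namespace RDExample

lemma unitBox_measurable (d : ℕ) (L : ℝ) : MeasurableSet (unitBox d L) :=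
  MeasurableSet.univ_pi fun _ => measurableSet_Ico

lemma volume_unitBox (d : ℕ) (L : ℝ) : volume (unitBox d L) = ENNReal.ofReal L ^ d := by
  unfold unitBox
  rw [volume_pi_pi]
  simp

instance (d : ℕ) (L : ℝ) : IsFiniteMeasure (boxMeasure d L) := by
  constructor
  rw [boxMeasure, Measure.restrict_apply_univ, volume_unitBox]
  exact ENNReal.pow_lt_top ENNReal.ofReal_lt_top

lemma boxMeasure_univ (d : ℕ) {L : ℝ} (hL : 0 < L) : (boxMeasure d L).real univ = L ^ d := by
  rw [measureReal_def, boxMeasure, Measure.restrict_apply_univ, volume_unitBox,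
    ENNReal.toReal_pow, ENNReal.toReal_ofReal hL.le]

section
variable {X : Type} [MetricSpace X] [CompactSpace X] {d : ℕ} {L : ℝ}

lemma dist_le_diam' (x y : X) : dist x y ≤ Metric.diam (univ : Set X) :=
  Metric.dist_le_diam_of_mem isCompact_univ.isBounded (mem_univ _) (mem_univ _)

lemma L1_integrable (f g : L1Maps d L X) :
    Integrable (fun u => dist (f u) (g u)) (boxMeasure d L) := by
  refine Integrable.of_bound (C := Metric.diam (univ : Set X)) ?_ (ae_of_all _ fun u => ?_)
  · exact f.aestronglyMeasurable.dist g.aestronglyMeasurable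
  · rw [Real.norm_of_nonneg dist_nonneg]; exact dist_le_diam' _ _

lemma L1dist_triangle (f g h : L1Maps d L X) : L1dist f h ≤ L1dist f g + L1dist g h := by
  unfold L1dist
  rw [← integral_add (L1_integrable _ _) (L1_integrable _ _)]
  exact integral_mono (L1_integrable _ _) ((L1_integrable _ _).add (L1_integrable _ _))
    fun u => dist_triangle _ _ _

lemma L1dist_symm (f g : L1Maps d L X) : L1dist f g = L1dist g f := by
  unfold L1dist; simp_rw [dist_comm]

lemma L1dist_nonneg (f g : L1Maps d L X) : 0 ≤ L1dist f g :=
  integral_nonneg fun _ => dist_nonneg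

lemma L1dist_measurable (f : L1Maps d L X) : Measurable (fun g => L1dist f g) := by
  refine measurable_of_Iio fun r => ?_
  exact MeasurableSpace.measurableSet_generateFrom ⟨f, r, rfl⟩

lemma L1dist_le (hL : 0 < L) (f g : L1Maps d L X) :
    L1dist f g ≤ Metric.diam (univ : Set X) * L ^ d := by
  unfold L1dist
  refine (integral_mono (L1_integrable f g) (integrable_const (Metric.diam (univ : Set X)))
    fun u => dist_le_diam' _ _).trans ?_
  rw [integral_const, boxMeasure_univ d hL, smul_eq_mul, mul_comm]

variable (T : (Fin d → ℝ) → X → X) (hT : IsContAction d T)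

/-- The orbit map of a point as an element of `L¹`. -/
noncomputable def orb (hT : IsContAction d T) (L : ℝ) (x : X) : L1Maps d L X :=
  AEEqFun.mk (fun u => T u x)
    (hT.1.comp (continuous_id.prodMk continuous_const)).aestronglyMeasurable

lemma orb_ae (x : X) : ∀ᵐ u ∂(boxMeasure d L), orb T hT L x u = T u x :=
  AEEqFun.coeFn_mk _ _

lemma L1dist_orb (x : X) (f : L1Maps d L X) :
    L1dist (orb T hT L x) f = ∫ u, dist (T u x) (f u) ∂(boxMeasure d L) := by
  unfold L1dist
  refine integral_congr_ae ?_
  filter_upwards [orb_ae T hT (L := L) x] with u hu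
  rw [hu]

lemma L1dist_orb_orb (x y : X) :
    L1dist (orb T hT L x) (orb T hT L y) = ∫ u, dist (T u x) (T u y) ∂(boxMeasure d L) := by
  rw [L1dist_orb]
  refine integral_congr_ae ?_
  filter_upwards [orb_ae T hT (L := L) y] with u hu
  rw [hu]

lemma L1dist_orb_continuous (f : L1Maps d L X) : Continuous fun x => L1dist (orb T hT L x) f := by
  simp_rw [L1dist_orb]
  refine continuous_of_dominated (bound := fun _ => Metric.diam (univ : Set X)) ?_ ?_
    (integrable_const _) ?_
  · intro x
    exact (hT.1.comp (continuous_id.prodMk continuous_const)).aestronglyMeasurable.dist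
      f.aestronglyMeasurable
  · intro x
    exact ae_of_all _ fun u => by rw [Real.norm_of_nonneg dist_nonneg]; exact dist_le_diam' _ _
  · exact ae_of_all _ fun u =>
      (hT.1.comp (continuous_const.prodMk continuous_id)).dist continuous_const

end

lemma exists_argmin {B : Type*} [MeasurableSpace B] {m : ℕ} (hm : 0 < m) (F : Fin m → B → ℝ)
    (hF : ∀ i, Measurable (F i)) :
    ∃ β : B → Fin m, Measurable β ∧ ∀ y j, F (β y) y ≤ F j y := by
  classical
  have : Nonempty (Fin m) := ⟨⟨0, hm⟩⟩
  let s : B → Finset (Fin m) := fun y => Finset.univ.filter fun i => ∀ j, F i y ≤ F j y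
  have hs : ∀ y, (s y).Nonempty := by
    intro y
    obtain ⟨i, hi⟩ := Finite.exists_min fun i => F i y
    exact ⟨i, by simp [s, hi]⟩
  refine ⟨fun y => (s y).min' (hs y), ?_, ?_⟩
  · refine measurable_to_countable' fun i => ?_
    have : (fun y => (s y).min' (hs y)) ⁻¹' {i} =
        {y | (∀ j, F i y ≤ F j y) ∧ ∀ i', i' < i → ¬ ∀ j, F i' y ≤ F j y} := by
      ext y
      simp only [mem_preimage, mem_singleton_iff, mem_setOf_eq]
      constructor
      · intro h
        constructor
        · have := (s y).min'_mem (hs y)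
          rw [h] at this
          simpa [s] using this
        · intro i' hi' hj
          have := (s y).min'_le i' (by simpa [s] using hj)
          rw [h] at this
          exact absurd hi' (not_lt.2 this)
      · rintro ⟨h1, h2⟩
        refine le_antisymm ((s y).min'_le i (by simpa [s] using h1)) ?_
        by_contra hlt
        push Not at hlt
        refine h2 _ hlt ?_
        have := (s y).min'_mem (hs y)
        simpa [s] using this
    rw [this]
    have hm' : ∀ i, MeasurableSet {y | ∀ j, F i y ≤ F j y} := by
      intro i
      rw [setOf_forall]
      exact MeasurableSet.iInter fun j => measurableSet_le (hF i) (hF j)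
    have h2 : {y | (∀ j, F i y ≤ F j y) ∧ ∀ i', i' < i → ¬ ∀ j, F i' y ≤ F j y} =
        {y | ∀ j, F i y ≤ F j y} ∩ ⋂ i', ⋂ (_ : i' < i), {y | ∀ j, F i' y ≤ F j y}ᶜ := by
      ext y; simp
    rw [h2]
    exact (hm' i).inter (MeasurableSet.iInter fun i' => MeasurableSet.iInter fun _ =>
      (hm' i').compl)
  · intro y j
    have := (s y).min'_mem (hs y)
    simp only [s, Finset.mem_filter, Finset.mem_univ, true_and] at this
    exact this j

section
variable {X : Type} [MetricSpace X] [CompactSpace X] [MeasurableSpace X] [BorelSpace X] {d : ℕ}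
  {L : ℝ} (T : (Fin d → ℝ) → X → X)

/-- Upper bound for `RL` by a finite quantizer. -/
lemma RL_upper (hT : IsContAction d T) (ν : Measure X) [IsProbabilityMeasure ν] (hL : 0 < L) {ι : Type} [Fintype ι] [MeasurableSpace ι] [DiscreteMeasurableSpace ι]
    (q : X → ι) (hq : Measurable q) (r : ι → X) {δ ε : ℝ} (hδε : δ < ε)
    (hδ : ∀ x, ∀ u ∈ unitBox d L, dist (T u x) (T u (r (q x))) ≤ δ) :
    RL d T ν L ε ≤ ENNReal.ofReal (Real.logb 2 (Fintype.card ι)) := by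
  have hY : Measurable fun x => orb T hT L (r (q x)) :=
    (Measurable.of_discrete (f := fun i => orb T hT L (r i))).comp hq
  unfold RL
  refine iInf_le_of_le X (iInf_le_of_le inferInstance (iInf_le_of_le ν (iInf_le_of_le inferInstance
    (iInf_le_of_le id (iInf_le_of_le (fun x => orb T hT L (r (q x))) (iInf_le_of_le measurable_id
    (iInf_le_of_le hY (iInf_le_of_le Measure.map_id (iInf_le_of_le ?_ ?_)))))))))
  · refine lt_of_le_of_lt ?_ hδε
    unfold distortion
    have hin : ∀ x, (L ^ d)⁻¹ * ∫ u, dist (T u (id x)) (orb T hT L (r (q x)) u) ∂(boxMeasure d L)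
        ≤ δ := by
      intro x
      rw [id, ← L1dist_orb T hT, L1dist_orb_orb]
      have : ∫ u, dist (T u x) (T u (r (q x))) ∂(boxMeasure d L) ≤ ∫ u, δ ∂(boxMeasure d L) := by
        refine integral_mono_of_nonneg (ae_of_all _ fun _ => dist_nonneg) (integrable_const _) ?_
        exact (ae_restrict_mem (unitBox_measurable d L)).mono fun u hu => hδ x u hu
      rw [integral_const, boxMeasure_univ d hL, smul_eq_mul] at this
      rw [inv_mul_le_iff₀ (by positivity)]
      exact this
    refine (integral_mono_of_nonneg (ae_of_all _ fun x => ?_) (integrable_const δ)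
      (ae_of_all _ hin)).trans (by simp)
    exact mul_nonneg (by positivity) (integral_nonneg fun _ => dist_nonneg)
  · exact mutualInfo_le ν id measurable_id q (fun i => orb T hT L (r i)) hY

/-- Lower bound for `RL`. -/
lemma RL_lower (hT : IsContAction d T) (ν : Measure X) [IsProbabilityMeasure ν] (hL : 0 < L) {s ε C : ℝ} (hs : 0 ≤ s) (hε : 0 < ε) (h : X → ℝ) (hh : Measurable h)
    (hC : ∀ x, |h x| ≤ C)
    (hZ : ∀ q : X, ∫ x, (2 : ℝ) ^ (h x - s * L1dist (orb T hT L x) (orb T hT L q)) ∂ν ≤ 1) :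
    ENNReal.ofReal (∫ x, h x ∂ν - s * (3 * ε * L ^ d)) ≤ RL d T ν L ε := by
  classical
  unfold RL
  refine le_iInf fun Ω => le_iInf fun _ => le_iInf fun P => le_iInf fun _ => le_iInf fun Xv =>
    le_iInf fun Yv => le_iInf fun hXv => le_iInf fun hYv => le_iInf fun hmap => le_iInf fun hd => ?_
  have hXne : Nonempty X := ν.nonempty_of_neZero
  have hLd : 0 < L ^ d := by positivity
  set η := ε * L ^ d with hη
  have hη0 : 0 < η := by positivity
  -- the finite net
  obtain ⟨t, ht⟩ := isCompact_univ.elim_finite_subcover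
    (fun q : X => {x | L1dist (orb T hT L x) (orb T hT L q) < η})
    (fun q => isOpen_lt (L1dist_orb_continuous T hT _) continuous_const)
    (fun x _ => mem_iUnion.2 ⟨x, by
      simp only [mem_setOf_eq, L1dist_orb_orb, dist_self, integral_zero]; exact hη0⟩)
  have htne : 0 < t.card := by
    rw [Finset.card_pos]
    obtain ⟨q, hq⟩ := mem_iUnion.1 (ht (mem_univ hXne.some))
    exact ⟨q, (mem_iUnion.1 hq).1⟩
  let qq : Fin t.card → X := fun i => (t.equivFin.symm i : X)
  have hqq : ∀ x, ∃ i, L1dist (orb T hT L x) (orb T hT L (qq i)) < η := by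
    intro x
    obtain ⟨q, hq⟩ := mem_iUnion.1 (ht (mem_univ x))
    obtain ⟨hqt, hq⟩ := mem_iUnion.1 hq
    exact ⟨t.equivFin ⟨q, hqt⟩, by simpa [qq] using hq⟩
  obtain ⟨β, hβ, hβmin⟩ := exists_argmin htne (fun i (f : L1Maps d L X) =>
    L1dist (orb T hT L (qq i)) f) (fun i => L1dist_measurable _)
  -- integrability of the distortion
  have hmeas : Measurable fun ω => L1dist (orb T hT L (Xv ω)) (Yv ω) := by
    have := measurable_uncurry_of_continuous_of_measurable
      (u := fun (x : X) (f : L1Maps d L X) => L1dist (orb T hT L x) f)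
      (fun f => L1dist_orb_continuous T hT f) (fun x => L1dist_measurable _)
    exact this.comp (hXv.prodMk hYv)
  have hint : Integrable (fun ω => L1dist (orb T hT L (Xv ω)) (Yv ω)) P := by
    refine Integrable.of_bound (C := Metric.diam (univ : Set X) * L ^ d)
      hmeas.aestronglyMeasurable (ae_of_all _ fun ω => ?_)
    rw [Real.norm_of_nonneg (L1dist_nonneg _ _)]
    exact L1dist_le hL _ _
  have hE : ∫ ω, L1dist (orb T hT L (Xv ω)) (Yv ω) ∂P ≤ ε * L ^ d := by
    unfold distortion at hd
    simp_rw [← L1dist_orb T hT] at hd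
    rw [integral_const_mul, inv_mul_lt_iff₀ hLd] at hd
    linarith
  let k : X → Fin t.card → ℝ := fun x j => h x - s * L1dist (orb T hT L x) (orb T hT L (qq j))
  have hk : ∀ j, Measurable fun x => k x j := fun j =>
    hh.sub ((L1dist_orb_continuous T hT (orb T hT L (qq j))).measurable.const_mul s)
  have hkC : ∀ x j, |k x j| ≤ C + s * (Metric.diam (univ : Set X) * L ^ d) := by
    intro x j
    refine (abs_sub _ _).trans (add_le_add (hC x) ?_)
    rw [abs_of_nonneg (mul_nonneg hs (L1dist_nonneg _ _))]
    gcongr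
    exact L1dist_le hL _ _
  have main := le_mutualInfo P Xv hXv Yv hYv β hβ k hk _ hkC (by
    intro j
    rw [← integral_map (φ := Xv) (f := fun x => (2 : ℝ) ^ (k x j)) hXv.aemeasurable
      ((hk j).const_pow 2).aestronglyMeasurable, hmap]
    exact hZ (qq j))
  refine le_trans (ENNReal.ofReal_le_ofReal ?_) main
  have hhint : Integrable (fun ω => h (Xv ω)) P :=
    Integrable.of_bound (C := C) (hh.comp hXv).aestronglyMeasurable
      (ae_of_all _ fun ω => by simpa using hC _)
  have hhm : ∫ x, h x ∂ν = ∫ ω, h (Xv ω) ∂P := by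
    rw [← hmap, integral_map hXv.aemeasurable hh.aestronglyMeasurable]
  have hpt : ∀ ω, h (Xv ω) - s * (2 * L1dist (orb T hT L (Xv ω)) (Yv ω) + η)
      ≤ k (Xv ω) (β (Yv ω)) := by
    intro ω
    obtain ⟨i, hi⟩ := hqq (Xv ω)
    have h1 := L1dist_triangle (orb T hT L (Xv ω)) (Yv ω) (orb T hT L (qq (β (Yv ω))))
    have h2 := hβmin (Yv ω) i
    have h3 := L1dist_triangle (orb T hT L (qq i)) (orb T hT L (Xv ω)) (Yv ω)
    rw [L1dist_symm (Yv ω)] at h1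
    rw [L1dist_symm (orb T hT L (qq i)) (orb T hT L (Xv ω))] at h3
    have h4 : L1dist (orb T hT L (Xv ω)) (orb T hT L (qq (β (Yv ω)))) ≤
      2 * L1dist (orb T hT L (Xv ω)) (Yv ω) + η := by linarith
    simp only [k]
    gcongr
  have hkm : Measurable fun ω => k (Xv ω) (β (Yv ω)) := by
    have : Measurable (fun p : X × Fin t.card => k p.1 p.2) :=
      measurable_from_prod_countable_left fun j => hk j
    exact this.comp (hXv.prodMk (hβ.comp hYv))
  have hki : Integrable (fun ω => k (Xv ω) (β (Yv ω))) P :=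
    Integrable.of_bound (C := C + s * (Metric.diam (univ : Set X) * L ^ d))
      hkm.aestronglyMeasurable (ae_of_all _ fun ω => hkC _ _)
  have hi2 : Integrable (fun ω => s * (2 * L1dist (orb T hT L (Xv ω)) (Yv ω) + η)) P :=
    ((hint.const_mul 2).add (integrable_const _)).const_mul s
  have := integral_mono (hhint.sub hi2) hki hpt
  refine le_trans ?_ this
  simp only [Pi.sub_apply]
  rw [integral_sub hhint hi2, integral_const_mul,
    integral_add (hint.const_mul 2) (integrable_const _), integral_const_mul, hhm]
  simp only [integral_const, probReal_univ, one_smul]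
  have : s * (2 * ∫ ω, L1dist (orb T hT L (Xv ω)) (Yv ω) ∂P + η) ≤ s * (3 * ε * L ^ d) := by
    gcongr
    rw [hη]; linarith
  linarith

/-- Upper bound for covering numbers by a finite quantizer. -/
lemma covNum_upper (hT : IsContAction d T) {ι : Type} [Fintype ι] (q : X → ι) (r : ι → X) {δ ε : ℝ} (hδ0 : 0 ≤ δ)
    (hδε : 2 * δ < ε)
    (hδ : ∀ x, ∀ u ∈ Set.Icc (0 : Fin d → ℝ) (fun _ => L), dist (T u x) (T u (r (q x))) < δ) :
    covNum X (dSup d T L) ε ≤ Fintype.card ι := by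
  classical
  let U : ι → Set X := fun i => {y | ∀ u ∈ Set.Icc (0 : Fin d → ℝ) (fun _ => L),
    dist (T u y) (T u (r i)) < δ}
  have hU : ∀ i, IsOpen (U i) := by
    intro i
    have hcl : IsClosed {p : (Set.Icc (0 : Fin d → ℝ) (fun _ => L)) × X |
        δ ≤ dist (T p.1 p.2) (T p.1 (r i))} := by
      refine isClosed_le continuous_const (Continuous.dist ?_ ?_)
      · exact hT.1.comp ((continuous_subtype_val.comp continuous_fst).prodMk continuous_snd)
      · exact hT.1.comp ((continuous_subtype_val.comp continuous_fst).prodMk continuous_const)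
    have := isClosedMap_snd_of_compactSpace _ hcl
    rw [← isClosed_compl_iff]
    convert this using 1
    ext y
    simp [U, and_assoc]
  unfold covNum
  refine le_trans (Nat.sInf_le (m := (Finset.univ.image U).card) ?_) Finset.card_image_le
  refine ⟨Finset.univ.image U, rfl, ?_, ?_⟩
  · intro V hV
    obtain ⟨i, -, rfl⟩ := Finset.mem_image.1 hV
    refine ⟨hU i, lt_of_le_of_lt ?_ ((ENNReal.ofReal_lt_ofReal_iff (by linarith)).2 hδε)⟩
    refine iSup_le fun x => iSup_le fun hx => iSup_le fun y => iSup_le fun hy =>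
      ENNReal.ofReal_le_ofReal ?_
    refine Real.iSup_le (fun u => ?_) (by linarith)
    have hu : u.1 ∈ Set.Icc (0 : Fin d → ℝ) (fun _ => L) :=
      ⟨fun i => (u.2 i (mem_univ i)).1, fun i => (u.2 i (mem_univ i)).2.le⟩
    have h1 := hx _ hu
    have h2 := hy _ hu
    have h3 := dist_triangle_right (T u.1 x) (T u.1 y) (T u.1 (r i))
    linarith
  · ext x
    simp only [Finset.coe_image, Finset.coe_univ, image_univ, sUnion_range, mem_iUnion, mem_univ,
      iff_true]
    exact ⟨q x, fun u hu => hδ x u hu⟩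

end

end RDExample

open MeasureTheory Filter Set
open scoped ENNReal Topology NNReal

namespace RDExample

/-! ### The bump function -/

/-- The union of the integer hyperplanes. -/
def gridSet (d : ℕ) : Set (Fin d → ℝ) := {v | ∃ i, ∃ k : ℤ, v i = k}

/-- The tent function vanishing on the integer hyperplanes. -/
noncomputable def psi {d : ℕ} (v : Fin d → ℝ) : ℝ := Metric.infDist v (gridSet d)

/-- Coordinatewise floor. -/
noncomputable def flr {d : ℕ} (v : Fin d → ℝ) : Fin d → ℤ := fun i => ⌊v i⌋

/-- Integer vectors as real vectors. -/
def castv {d : ℕ} (k : Fin d → ℤ) : Fin d → ℝ := fun i => (k i : ℝ)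

section
variable {d : ℕ}

lemma psi_nonneg (v : Fin d → ℝ) : 0 ≤ psi v := Metric.infDist_nonneg

lemma psi_sub_le (v v' : Fin d → ℝ) : |psi v - psi v'| ≤ dist v v' := by
  have := (Metric.lipschitz_infDist_pt (gridSet d)).dist_le_mul v v'
  simpa [psi, Real.dist_eq] using this

lemma psi_le (v : Fin d → ℝ) (i : Fin d) (k : ℤ) : psi v ≤ |v i - k| := by
  have hm : Function.update v i (k : ℝ) ∈ gridSet d := ⟨i, k, by simp⟩
  refine (Metric.infDist_le_dist_of_mem hm).trans ?_
  rw [dist_pi_le_iff (abs_nonneg _)]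
  intro j
  by_cases h : j = i
  · subst h; simp [Real.dist_eq]
  · simp [h]

lemma gridSet_nonempty [NeZero d] : (gridSet d).Nonempty := ⟨0, 0, 0, by simp⟩

lemma psi_le_one [NeZero d] (v : Fin d → ℝ) : psi v ≤ 1 := by
  refine (psi_le v 0 ⌊v 0⌋).trans ?_
  rw [abs_le]
  have h1 := Int.floor_le (v 0)
  have h2 := Int.lt_floor_add_one (v 0)
  constructor <;> linarith

lemma le_psi [NeZero d] (v : Fin d → ℝ) (z : Fin d → ℤ)
    (h : ∀ i, |v i - z i - 1 / 2| ≤ 3 / 8) : 1 / 8 ≤ psi v := by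
  unfold psi
  rw [Metric.le_infDist gridSet_nonempty]
  rintro g ⟨i, k, hk⟩
  refine le_trans ?_ (dist_le_pi_dist v g i)
  rw [Real.dist_eq, hk]
  have h1 := abs_le.1 (h i)
  rcases le_or_gt k (z i) with h2 | h2
  · have : (k : ℝ) ≤ z i := by exact_mod_cast h2
    refine le_trans ?_ (le_abs_self _)
    linarith
  · have : (z i : ℝ) + 1 ≤ k := by exact_mod_cast h2
    refine le_trans ?_ (neg_le_abs _)
    linarith

lemma psi_add_le [NeZero d] (v : Fin d → ℝ) (k : Fin d → ℤ) : psi (v + castv k) ≤ psi v := by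
  conv_rhs => unfold psi
  rw [Metric.le_infDist gridSet_nonempty]
  rintro g ⟨i, l, hl⟩
  have hm : g + castv k ∈ gridSet d := ⟨i, l + k i, by simp [hl, castv]⟩
  refine (Metric.infDist_le_dist_of_mem hm).trans ?_
  rw [dist_add_right]

lemma psi_add [NeZero d] (v : Fin d → ℝ) (k : Fin d → ℤ) : psi (v + castv k) = psi v := by
  refine le_antisymm (psi_add_le v k) ?_
  have := psi_add_le (v + castv k) (-k)
  have h2 : v + castv k + castv (-k) = v := by ext i; simp [castv]
  rwa [h2] at this

lemma flr_add (v : Fin d → ℝ) (k : Fin d → ℤ) : flr (v + castv k) = flr v + k := by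
  ext i; simp [flr, castv]

lemma psi_add_psi_le (v v' : Fin d → ℝ) (h : flr v ≠ flr v') : psi v + psi v' ≤ dist v v' := by
  obtain ⟨i, hi⟩ := Function.ne_iff.1 h
  simp only [flr] at hi
  refine le_trans ?_ (dist_le_pi_dist v v' i)
  rw [Real.dist_eq]
  rcases lt_or_gt_of_ne hi with h1 | h1
  · have h2 := psi_le v i ⌊v' i⌋
    have h3 := psi_le v' i ⌊v' i⌋
    have h4 : v i < ⌊v' i⌋ := Int.floor_lt.1 h1
    have h5 := Int.floor_le (v' i)
    rw [abs_of_nonpos (by linarith)] at h2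
    rw [abs_of_nonneg (by linarith)] at h3
    rw [abs_of_nonpos (by linarith)]
    linarith
  · have h2 := psi_le v i ⌊v i⌋
    have h3 := psi_le v' i ⌊v i⌋
    have h4 : v' i < ⌊v i⌋ := Int.floor_lt.1 h1
    have h5 := Int.floor_le (v i)
    rw [abs_of_nonneg (by linarith)] at h2
    rw [abs_of_nonpos (by linarith)] at h3
    rw [abs_of_nonneg (by linarith)]
    linarith

end

/-! ### The space -/

/-- Bit arrays. -/
abbrev Bits (d : ℕ) := (Fin d → ℤ) × ℕ → Bool

/-- The value at `v` of the `n`-th signal associated with a bit array. -/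
noncomputable def FF {d : ℕ} (ω : Bits d) (v : Fin d → ℝ) (n : ℕ) : ℝ :=
  if ω (flr v, n) = true then psi v else 0

open Classical in
/-- The weight of the `n`-th signal. -/
noncomputable def cc (J : Set ℕ) (n : ℕ) : ℝ := if n ∈ J then (2 : ℝ)⁻¹ ^ n else 0

/-- The index set, with the discrete topology. -/
def Idx (d : ℕ) := (Fin d → ℝ) × ℕ

instance (d : ℕ) : TopologicalSpace (Idx d) := ⊥
instance (d : ℕ) : DiscreteTopology (Idx d) := ⟨rfl⟩

section
variable {d : ℕ} [NeZero d] (J : Set ℕ)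

lemma cc_nonneg (n : ℕ) : 0 ≤ cc J n := by unfold cc; split_ifs <;> positivity
lemma cc_le (n : ℕ) : cc J n ≤ (2 : ℝ)⁻¹ ^ n := by unfold cc; split_ifs <;> [exact le_rfl; positivity]
lemma cc_le_one (n : ℕ) : cc J n ≤ 1 := (cc_le J n).trans (pow_le_one₀ (by norm_num) (by norm_num))

lemma FF_nonneg (ω : Bits d) (v : Fin d → ℝ) (n : ℕ) : 0 ≤ FF ω v n := by
  unfold FF; split_ifs <;> [exact psi_nonneg v; exact le_rfl]

lemma FF_le_one (ω : Bits d) (v : Fin d → ℝ) (n : ℕ) : FF ω v n ≤ 1 := by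
  unfold FF; split_ifs <;> [exact psi_le_one v; exact zero_le_one]

lemma FF_le_psi (ω : Bits d) (v : Fin d → ℝ) (n : ℕ) : FF ω v n ≤ psi v := by
  unfold FF; split_ifs <;> [exact le_rfl; exact psi_nonneg v]

lemma FF_sub_le (ω : Bits d) (v v' : Fin d → ℝ) (n : ℕ) :
    |FF ω v n - FF ω v' n| ≤ dist v v' := by
  by_cases h : flr v = flr v'
  · unfold FF
    rw [h]
    split_ifs
    · exact psi_sub_le v v'
    · simp
  · have h0 := psi_add_psi_le v v' h
    have h1 := FF_nonneg ω v n
    have h2 := FF_le_psi ω v n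
    have h3 := FF_nonneg ω v' n
    have h4 := FF_le_psi ω v' n
    rw [abs_le]; constructor <;> linarith

lemma FF_sub_le_one (ω ω' : Bits d) (v v' : Fin d → ℝ) (n : ℕ) :
    |FF ω v n - FF ω' v' n| ≤ 1 := by
  have h1 := FF_nonneg ω v n
  have h2 := FF_le_one ω v n
  have h3 := FF_nonneg ω' v' n
  have h4 := FF_le_one ω' v' n
  rw [abs_le]; constructor <;> linarith

/-- The coordinates of a point. -/
noncomputable def val (v : Fin d → ℝ) (ω : Bits d) (p : Idx d) : ℝ :=
  (1 + ‖p.1‖)⁻¹ * (cc J p.2 * FF ω (v + p.1) p.2)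

lemma wt_nonneg (u : Fin d → ℝ) : 0 ≤ (1 + ‖u‖)⁻¹ := by positivity
lemma wt_le_one (u : Fin d → ℝ) : (1 + ‖u‖)⁻¹ ≤ 1 :=
  inv_le_one_of_one_le₀ (by linarith [norm_nonneg u])

lemma val_bound (v : Fin d → ℝ) (ω : Bits d) (p : Idx d) : ‖val J v ω p‖ ≤ 1 := by
  unfold val
  have h1 := wt_nonneg p.1
  have h2 := wt_le_one p.1
  have h3 := FF_nonneg ω (v + p.1) p.2
  have h4 := FF_le_one ω (v + p.1) p.2
  have h5 := cc_nonneg J p.2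
  have h6 := cc_le_one J p.2
  rw [Real.norm_of_nonneg (by positivity)]
  exact mul_le_one₀ h2 (by positivity) (mul_le_one₀ h6 h3 h4)

lemma val_sub (v v' : Fin d → ℝ) (ω ω' : Bits d) (p : Idx d) :
    |val J v ω p - val J v' ω' p| =
      (1 + ‖p.1‖)⁻¹ * (cc J p.2 * |FF ω (v + p.1) p.2 - FF ω' (v' + p.1) p.2|) := by
  unfold val
  rw [← mul_sub, ← mul_sub, abs_mul, abs_mul, abs_of_nonneg (wt_nonneg p.1),
    abs_of_nonneg (cc_nonneg J _)]

/-- The ambient metric space. -/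
abbrev Amb (d : ℕ) := (Fin d → UnitAddCircle) × BoundedContinuousFunction (Idx d) ℝ

/-- The parametrization of the space. -/
noncomputable def Phi (v : Fin d → ℝ) (ω : Bits d) : Amb d :=
  (fun i => (v i : UnitAddCircle),
    BoundedContinuousFunction.ofNormedAddCommGroupDiscrete (val J v ω) 1 (val_bound J v ω))

lemma Phi_dist_le {v v' : Fin d → ℝ} {ω ω' : Bits d} {C : ℝ} (hC : 0 ≤ C)
    (h1 : ∀ i, dist (v i : UnitAddCircle) (v' i) ≤ C)
    (h2 : ∀ p, |val J v ω p - val J v' ω' p| ≤ C) :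
    dist (Phi J v ω) (Phi J v' ω') ≤ C := by
  rw [Prod.dist_eq, max_le_iff]
  constructor
  · rw [dist_pi_le_iff hC]; exact h1
  · rw [BoundedContinuousFunction.dist_le hC]; exact h2

lemma circ_le_Phi (v v' : Fin d → ℝ) (ω ω' : Bits d) (i : Fin d) :
    dist (v i : UnitAddCircle) (v' i) ≤ dist (Phi J v ω) (Phi J v' ω') := by
  rw [Prod.dist_eq]
  refine le_trans ?_ (le_max_left _ _)
  exact dist_le_pi_dist (fun i => (v i : UnitAddCircle)) (fun i => (v' i : UnitAddCircle)) i

lemma val_le_Phi (v v' : Fin d → ℝ) (ω ω' : Bits d) (p : Idx d) :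
    |val J v ω p - val J v' ω' p| ≤ dist (Phi J v ω) (Phi J v' ω') := by
  rw [Prod.dist_eq]
  refine le_trans ?_ (le_max_right _ _)
  exact BoundedContinuousFunction.dist_coe_le_dist (f := (Phi J v ω).2) (g := (Phi J v' ω').2) p

lemma circ_dist_le (x y : ℝ) : dist (x : UnitAddCircle) (y : UnitAddCircle) ≤ |x - y| := by
  rw [dist_eq_norm, ← AddCircle.coe_sub]
  exact (QuotientAddGroup.norm_mk_le_norm).trans (by simp)

lemma Phi_lip (v v' : Fin d → ℝ) (ω : Bits d) :
    dist (Phi J v ω) (Phi J v' ω) ≤ dist v v' := by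
  refine Phi_dist_le J dist_nonneg ?_ ?_
  · intro i
    exact (circ_dist_le _ _).trans (dist_le_pi_dist v v' i)
  · intro p
    rw [val_sub]
    have h := FF_sub_le ω (v + p.1) (v' + p.1) p.2
    rw [dist_add_right] at h
    have h2 := wt_le_one p.1
    have h5 := cc_nonneg J p.2
    have h6 := cc_le_one J p.2
    calc _ ≤ 1 * (1 * dist v v') := by gcongr
      _ = _ := by ring

lemma Phi_expand (v v' u : Fin d → ℝ) (ω ω' : Bits d) :
    dist (Phi J (v + u) ω) (Phi J (v' + u) ω') ≤ (1 + ‖u‖) * dist (Phi J v ω) (Phi J v' ω') := by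
  refine Phi_dist_le J (by positivity) ?_ ?_
  · intro i
    have h1 := circ_le_Phi J v v' ω ω' i
    have : dist (((v + u) i : ℝ) : UnitAddCircle) ((v' + u) i : ℝ) =
        dist (v i : UnitAddCircle) (v' i) := by
      simp only [Pi.add_apply, AddCircle.coe_add, dist_add_right]
    rw [this]
    nlinarith [norm_nonneg u, dist_nonneg (x := Phi J v ω) (y := Phi J v' ω')]
  · intro p
    have h1 := val_le_Phi J v v' ω ω' (u + p.1, p.2)
    rw [val_sub J v v' ω ω' (u + p.1, p.2)] at h1
    rw [val_sub]
    simp only [← add_assoc] at h1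
    set A := cc J p.2 * |FF ω (v + u + p.1) p.2 - FF ω' (v' + u + p.1) p.2|
    have hA : 0 ≤ A := mul_nonneg (cc_nonneg J _) (abs_nonneg _)
    have h2 : A ≤ (1 + ‖u + p.1‖) * dist (Phi J v ω) (Phi J v' ω') := by
      rw [← inv_mul_le_iff₀ (by positivity)]; exact h1
    have h3 : 1 + ‖u + p.1‖ ≤ (1 + ‖u‖) * (1 + ‖p.1‖) := by
      nlinarith [norm_add_le u p.1, norm_nonneg u, norm_nonneg p.1]
    rw [inv_mul_le_iff₀ (by positivity)]
    refine h2.trans ?_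
    calc _ ≤ ((1 + ‖u‖) * (1 + ‖p.1‖)) * dist (Phi J v ω) (Phi J v' ω') := by gcongr
      _ = _ := by ring

lemma Phi_window (v : Fin d → ℝ) (ω ω' : Bits d) (r : ℝ) (hr : 0 ≤ r) (m : ℕ)
    (h : ∀ z : Fin d → ℤ, ∀ n, n ∈ J → n ≤ m → (∀ i, |(z i : ℝ) - v i| ≤ r + 1) →
      ω (z, n) = ω' (z, n)) :
    dist (Phi J v ω) (Phi J v ω') ≤ max ((2 : ℝ)⁻¹ ^ (m + 1)) (1 + r)⁻¹ := by
  refine Phi_dist_le J (by positivity) (fun i => by simp) ?_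
  intro p
  rw [val_sub]
  have h1 := wt_nonneg p.1
  have h2 := wt_le_one p.1
  have h5 := cc_nonneg J p.2
  have h6 := cc_le_one J p.2
  have h7 := FF_sub_le_one ω ω' (v + p.1) (v + p.1) p.2
  by_cases hJ : p.2 ∈ J
  swap
  · simp only [cc, hJ, if_false, zero_mul, mul_zero]; positivity
  by_cases hm : p.2 ≤ m
  swap
  · have : cc J p.2 ≤ (2 : ℝ)⁻¹ ^ (m + 1) :=
      (cc_le J p.2).trans (pow_le_pow_of_le_one (by norm_num) (by norm_num) (by omega))
    refine le_trans ?_ (le_max_left _ _)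
    calc _ ≤ 1 * ((2 : ℝ)⁻¹ ^ (m + 1) * 1) := by gcongr
      _ = _ := by ring
  by_cases hrp : ‖p.1‖ ≤ r
  swap
  · refine le_trans ?_ (le_max_right _ _)
    have : (1 + ‖p.1‖)⁻¹ ≤ (1 + r)⁻¹ := by gcongr; linarith
    calc _ ≤ (1 + r)⁻¹ * (1 * 1) := by gcongr
      _ = _ := by ring
  have : FF ω (v + p.1) p.2 = FF ω' (v + p.1) p.2 := by
    unfold FF
    rw [h _ _ hJ hm]
    intro i
    have h8 := Int.floor_le ((v + p.1) i)
    have h9 := Int.lt_floor_add_one ((v + p.1) i)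
    have h10 := abs_le.1 ((norm_le_pi_norm p.1 i).trans hrp)
    simp only [Pi.add_apply] at h8 h9
    simp only [flr, Pi.add_apply]
    rw [abs_le]; constructor <;> linarith [h10.1, h10.2]
  rw [this]; simp

/-- Shifting a bit array. -/
def shiftB (k : Fin d → ℤ) (ω : Bits d) : Bits d := fun p => ω (p.1 + k, p.2)

lemma Phi_shift (v : Fin d → ℝ) (k : Fin d → ℤ) (ω : Bits d) :
    Phi J (v + castv k) ω = Phi J v (shiftB k ω) := by
  refine dist_le_zero.1 (Phi_dist_le J le_rfl ?_ ?_)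
  · intro i
    simp [castv]
  · intro p
    rw [val_sub]
    have : FF ω (v + castv k + p.1) p.2 = FF (shiftB k ω) (v + p.1) p.2 := by
      have h : v + castv k + p.1 = v + p.1 + castv k := by abel
      unfold FF shiftB
      rw [h, flr_add, psi_add]
    rw [this]; simp

lemma Phi_continuous : Continuous fun p : (Fin d → ℝ) × Bits d => Phi J p.1 p.2 := by
  rw [continuous_iff_continuousAt]
  rintro ⟨v, ω⟩
  rw [ContinuousAt, Metric.tendsto_nhds]
  intro ε hε
  obtain ⟨m, hm⟩ := exists_pow_lt_of_lt_one (half_pos hε) (by norm_num : (2 : ℝ)⁻¹ < 1)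
  obtain ⟨r, hr⟩ := exists_nat_gt (2 / ε)
  have hr' : (1 + (r : ℝ))⁻¹ < ε / 2 := by
    rw [inv_lt_comm₀ (by positivity) (by positivity)]
    rw [inv_div]; linarith
  let W : Finset ((Fin d → ℤ) × ℕ) :=
    (Fintype.piFinset fun i => Finset.Icc ⌊v i - r - 1⌋ ⌈v i + r + 1⌉) ×ˢ Finset.range (m + 1)
  have hev : ∀ᶠ ω' in 𝓝 ω, ∀ p ∈ W, ω' p = ω p := by
    rw [Filter.eventually_all_finset]
    intro p _
    have : Tendsto (fun ω' : Bits d => ω' p) (𝓝 ω) (𝓝 (ω p)) := (continuous_apply p).tendsto _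
    exact this.eventually ((isOpen_discrete {ω p}).mem_nhds rfl)
  have hev1 : ∀ᶠ v' in 𝓝 v, dist v' v < ε / 2 := Metric.ball_mem_nhds v (half_pos hε)
  rw [nhds_prod_eq]
  filter_upwards [hev1.prod_mk hev] with ⟨v', ω'⟩ ⟨h1, h2⟩
  have h3 := Phi_lip J v' v ω'
  have h4 := Phi_window J v ω' ω r (by positivity) m (by
    intro z n _ hn hz
    refine h2 (z, n) ?_
    simp only [W, Finset.mem_product, Fintype.mem_piFinset, Finset.mem_Icc, Finset.mem_range]
    refine ⟨fun i => ?_, by omega⟩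
    have := abs_le.1 (hz i)
    constructor
    · have : (⌊v i - r - 1⌋ : ℝ) ≤ z i := (Int.floor_le _).trans (by linarith)
      exact_mod_cast this
    · have : (z i : ℝ) ≤ ⌈v i + r + 1⌉ := le_trans (by linarith) (Int.le_ceil _)
      exact_mod_cast this)
  have h5 : max ((2 : ℝ)⁻¹ ^ (m + 1)) (1 + (r : ℝ))⁻¹ < ε / 2 := by
    refine max_lt (lt_of_le_of_lt ?_ hm) hr'
    exact pow_le_pow_of_le_one (by norm_num) (by norm_num) (by omega)
  have h6 := dist_triangle (Phi J v' ω') (Phi J v ω') (Phi J v ω)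
  simp only at h1
  linarith

/-- The space. -/
def Spc (d : ℕ) [NeZero d] (J : Set ℕ) : Type :=
  ↥(Set.range fun p : (Fin d → ℝ) × Bits d => Phi J p.1 p.2)

noncomputable instance : MetricSpace (Spc d J) :=
  inferInstanceAs (MetricSpace ↥(Set.range fun p : (Fin d → ℝ) × Bits d => Phi J p.1 p.2))
noncomputable instance : MeasurableSpace (Spc d J) := borel _
instance : BorelSpace (Spc d J) := ⟨rfl⟩

/-- Points of the space. -/
noncomputable def mk (v : Fin d → ℝ) (ω : Bits d) : Spc d J := ⟨Phi J v ω, ⟨(v, ω), rfl⟩⟩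

lemma dist_mk (v v' : Fin d → ℝ) (ω ω' : Bits d) :
    dist (mk J v ω) (mk J v' ω') = dist (Phi J v ω) (Phi J v' ω') := rfl

lemma mk_continuous : Continuous fun p : (Fin d → ℝ) × Bits d => mk J p.1 p.2 :=
  (Phi_continuous J).subtype_mk _

lemma mk_shift (v : Fin d → ℝ) (k : Fin d → ℤ) (ω : Bits d) :
    mk J (v + castv k) ω = mk J v (shiftB k ω) := Subtype.ext (Phi_shift J v k ω)

lemma exists_mk (x : Spc d J) : ∃ v ω, x = mk J v ω := by
  obtain ⟨x, ⟨v, ω⟩, rfl⟩ := x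
  exact ⟨v, ω, rfl⟩

lemma exists_mk' (x : Spc d J) : ∃ v ∈ unitBox d 1, ∃ ω, x = mk J v ω := by
  obtain ⟨v, ω, rfl⟩ := exists_mk J x
  refine ⟨fun i => Int.fract (v i), fun i _ => ⟨Int.fract_nonneg _, Int.fract_lt_one _⟩,
    shiftB (flr v) ω, ?_⟩
  rw [← mk_shift]
  congr 1
  ext i
  simp [castv, flr]

instance : CompactSpace (Spc d J) := by
  constructor
  have h : (univ : Set (Spc d J)) = (fun p : (Fin d → ℝ) × Bits d => mk J p.1 p.2) ''
      ((Set.univ.pi fun _ => Set.Icc (0 : ℝ) 1) ×ˢ univ) := by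
    symm
    rw [eq_univ_iff_forall]
    intro x
    obtain ⟨v, hv, ω, rfl⟩ := exists_mk' J x
    exact ⟨(v, ω), ⟨fun i hi => Ico_subset_Icc_self (hv i hi), mem_univ _⟩, rfl⟩
  rw [h]
  exact ((isCompact_univ_pi fun _ => isCompact_Icc).prod isCompact_univ).image (mk_continuous J)

/-- The action. -/
noncomputable def act (u : Fin d → ℝ) (x : Spc d J) : Spc d J :=
  mk J ((exists_mk J x).choose + u) (exists_mk J x).choose_spec.choose

lemma act_mk (u v : Fin d → ℝ) (ω : Bits d) : act J u (mk J v ω) = mk J (v + u) ω := by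
  have h := (exists_mk J (mk J v ω)).choose_spec.choose_spec
  unfold act
  generalize (exists_mk J (mk J v ω)).choose_spec.choose = ω' at *
  generalize (exists_mk J (mk J v ω)).choose = v' at *
  refine dist_le_zero.1 ?_
  rw [dist_mk]
  refine (Phi_expand J v' v u ω' ω).trans ?_
  rw [← dist_mk, ← h, dist_self, mul_zero]

lemma act_dist (u : Fin d → ℝ) (x y : Spc d J) :
    dist (act J u x) (act J u y) ≤ (1 + ‖u‖) * dist x y := by
  obtain ⟨v, ω, rfl⟩ := exists_mk J x
  obtain ⟨v', ω', rfl⟩ := exists_mk J y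
  rw [act_mk, act_mk]
  exact Phi_expand J v v' u ω ω'

lemma act_lip (u u' : Fin d → ℝ) (x : Spc d J) :
    dist (act J u x) (act J u' x) ≤ dist u u' := by
  obtain ⟨v, ω, rfl⟩ := exists_mk J x
  rw [act_mk, act_mk, dist_mk]
  refine (Phi_lip J _ _ _).trans ?_
  rw [dist_add_left]

lemma act_isContAction : IsContAction d (act (d := d) J) := by
  refine ⟨?_, ?_, ?_⟩
  · rw [continuous_iff_continuousAt]
    rintro ⟨u, x⟩
    rw [ContinuousAt, tendsto_iff_dist_tendsto_zero]
    have hc : Continuous fun p : (Fin d → ℝ) × Spc d J => dist p.1 u + (1 + ‖u‖) * dist p.2 x := by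
      fun_prop
    have ht := hc.tendsto (u, x)
    simp only [dist_self, mul_zero, add_zero] at ht
    refine squeeze_zero (fun _ => dist_nonneg) (fun p => ?_) ht
    refine (dist_triangle _ (act J u p.2) _).trans ?_
    exact add_le_add (act_lip J _ _ _) (act_dist J _ _ _)
  · intro x
    obtain ⟨v, ω, rfl⟩ := exists_mk J x
    rw [act_mk, add_zero]
  · intro u v x
    obtain ⟨v, ω, rfl⟩ := exists_mk J x
    rw [act_mk, act_mk, act_mk]
    congr 1; abel

end
end RDExample

open MeasureTheory Filter Set
open scoped ENNReal Topology NNReal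

namespace RDExample

/-! ### Upper bounds -/

section
variable {X : Type} [MetricSpace X] [CompactSpace X] [MeasurableSpace X] [BorelSpace X] {d : ℕ}

lemma isOpen_tube (T : (Fin d → ℝ) → X → X) (hT : IsContAction d T) (L δ : ℝ) (p : X) :
    IsOpen {y | ∀ u ∈ Set.Icc (0 : Fin d → ℝ) (fun _ => L), dist (T u y) (T u p) < δ} := by
  have hcl : IsClosed {q : (Set.Icc (0 : Fin d → ℝ) (fun _ => L)) × X |
      δ ≤ dist (T q.1 q.2) (T q.1 p)} := by
    refine isClosed_le continuous_const (Continuous.dist ?_ ?_)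
    · exact hT.1.comp ((continuous_subtype_val.comp continuous_fst).prodMk continuous_snd)
    · exact hT.1.comp ((continuous_subtype_val.comp continuous_fst).prodMk continuous_const)
  have := isClosedMap_snd_of_compactSpace _ hcl
  rw [← isClosed_compl_iff]
  convert this using 1
  ext y
  simp [and_assoc]

lemma exists_measurable_quantizer (T : (Fin d → ℝ) → X → X) (hT : IsContAction d T) (L δ : ℝ)
    [Nonempty X] {m : ℕ} (r : Fin m → X)
    (h : ∀ x, ∃ i, ∀ u ∈ Set.Icc (0 : Fin d → ℝ) (fun _ => L), dist (T u x) (T u (r i)) < δ) :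
    ∃ q : X → Fin m, Measurable q ∧ ∀ x, ∀ u ∈ Set.Icc (0 : Fin d → ℝ) (fun _ => L),
      dist (T u x) (T u (r (q x))) < δ := by
  classical
  let U : Fin m → Set X := fun i =>
    {y | ∀ u ∈ Set.Icc (0 : Fin d → ℝ) (fun _ => L), dist (T u y) (T u (r i)) < δ}
  have hm : 0 < m := by
    obtain ⟨i, -⟩ := h (Classical.arbitrary X)
    exact i.pos
  obtain ⟨q, hq, hmin⟩ := exists_argmin hm (fun i => (U i)ᶜ.indicator fun _ => (1 : ℝ))
    (fun i => measurable_const.indicator (isOpen_tube T hT L δ (r i)).measurableSet.compl)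
  refine ⟨q, hq, fun x => ?_⟩
  obtain ⟨i, hi⟩ := h x
  have h1 := hmin x i
  have hxi : x ∈ U i := hi
  rw [indicator_of_notMem (s := (U i)ᶜ) (by simpa using hxi)] at h1
  by_contra hcon
  have hx : x ∈ (U (q x))ᶜ := hcon
  rw [indicator_of_mem hx] at h1
  linarith

/-- Both upper bounds from a finite cover. -/
lemma cover_bounds (T : (Fin d → ℝ) → X → X) (hT : IsContAction d T) (ν : Measure X)
    [IsProbabilityMeasure ν] {L δ : ℝ} (hL : 0 < L) (hδ0 : 0 ≤ δ) {ι : Type} [Fintype ι]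
    (r : ι → X)
    (h : ∀ x, ∃ i, ∀ u ∈ Set.Icc (0 : Fin d → ℝ) (fun _ => L), dist (T u x) (T u (r i)) < δ) :
    (∀ ε, δ < ε → RL d T ν L ε ≤ ENNReal.ofReal (Real.logb 2 (Fintype.card ι))) ∧
    (∀ ε, 2 * δ < ε → covNum X (dSup d T L) ε ≤ Fintype.card ι) := by
  have : Nonempty X := ν.nonempty_of_neZero
  let e := Fintype.equivFin ι
  obtain ⟨q, hq, hqd⟩ := exists_measurable_quantizer T hT L δ (fun i => r (e.symm i)) (by
    intro x
    obtain ⟨i, hi⟩ := h x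
    exact ⟨e i, by simpa using hi⟩)
  constructor
  · intro ε hε
    have := RL_upper T hT ν hL q hq (fun i => r (e.symm i)) hε (by
      intro x u hu
      exact (hqd x u ⟨fun i => (hu i (mem_univ i)).1, fun i => (hu i (mem_univ i)).2.le⟩).le)
    simpa using this
  · intro ε hε
    have := covNum_upper T hT q (fun i => r (e.symm i)) hδ0 hε hqd
    simpa using this

end

open Classical in
/-- The number of free digits up to `m`. -/
noncomputable def digs (J : Set ℕ) (m : ℕ) : Finset ℕ := (Finset.range (m + 1)).filter (· ∈ J)

section
variable {d : ℕ} [NeZero d] (J : Set ℕ)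

/-- The finite cover. -/
lemma exists_cover (L : ℝ) (hL : 0 < L) (M r m : ℕ) (hM : 0 < M) (δ : ℝ)
    (hδ : (M : ℝ)⁻¹ + max ((2 : ℝ)⁻¹ ^ (m + 1)) (1 + (r : ℝ))⁻¹ < δ) :
    ∃ (ι : Type) (_ : Fintype ι) (p : ι → Spc d J),
      (∀ x, ∃ i, ∀ u ∈ Set.Icc (0 : Fin d → ℝ) (fun _ => L),
        dist (act J u x) (act J u (p i)) < δ) ∧
      Real.logb 2 (Fintype.card ι) ≤
        d * Real.logb 2 M + (digs J m).card * (L + 2 * r + 6) ^ d := by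
  classical
  let W : Finset (Fin d → ℤ) :=
    Fintype.piFinset fun _ => Finset.Icc (-(r : ℤ) - 1) (⌈L⌉ + r + 2)
  let D := digs J m
  let ι := (Fin d → Fin M) × (W × D → Bool)
  let g : (Fin d → Fin M) → (Fin d → ℝ) := fun g i => ((g i : ℕ) : ℝ) / M
  let ext : (W × D → Bool) → Bits d := fun η p =>
    if h : p.1 ∈ W ∧ p.2 ∈ D then η (⟨p.1, h.1⟩, ⟨p.2, h.2⟩) else false
  have hM' : (0 : ℝ) < M := by exact_mod_cast hM
  refine ⟨ι, inferInstance, fun i => mk J (g i.1) (ext i.2), ?_, ?_⟩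
  · intro x
    obtain ⟨v, hv, ω, rfl⟩ := exists_mk' J x
    have hv0 : ∀ i, 0 ≤ v i := fun i => (hv i (mem_univ i)).1
    have hv1 : ∀ i, v i < 1 := fun i => (hv i (mem_univ i)).2
    have hfl : ∀ i, ⌊v i * M⌋₊ < M := by
      intro i
      rw [Nat.floor_lt (mul_nonneg (hv0 i) hM'.le)]
      nlinarith [hv1 i]
    let gi : Fin d → Fin M := fun i => ⟨⌊v i * M⌋₊, hfl i⟩
    have hgi0 : ∀ i, 0 ≤ g gi i := fun i => by simp only [g]; positivity
    have hgile : ∀ i, g gi i ≤ v i := fun i => by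
      simp only [g, gi]
      rw [div_le_iff₀ hM']
      exact Nat.floor_le (mul_nonneg (hv0 i) hM'.le)
    have hgige : ∀ i, v i ≤ g gi i + (M : ℝ)⁻¹ := fun i => by
      simp only [g, gi]
      have := (Nat.lt_floor_add_one (v i * M)).le
      rw [inv_eq_one_div, ← add_div, le_div_iff₀ hM']
      exact this
    refine ⟨(gi, fun p => ω (p.1.1, p.2.1)), fun u hu => lt_of_le_of_lt ?_ hδ⟩
    rw [act_mk, act_mk]
    refine (dist_triangle _ (mk J (g gi + u) ω) _).trans (add_le_add ?_ ?_)
    · rw [dist_mk]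
      refine (Phi_lip J _ _ _).trans ?_
      rw [dist_add_right, dist_pi_le_iff (by positivity)]
      intro i
      rw [Real.dist_eq, abs_le]
      have : 0 ≤ (M : ℝ)⁻¹ := by positivity
      constructor <;> linarith [hgile i, hgige i]
    · rw [dist_mk]
      refine Phi_window J _ _ _ r (by positivity) m ?_
      intro z n hnJ hnm hz
      have hzW : z ∈ W := by
        simp only [W, Fintype.mem_piFinset, Finset.mem_Icc]
        intro i
        have h1 := abs_le.1 (hz i)
        have h2 := hu.1 i
        have h3 := hu.2 i
        have h4 := hgi0 i
        have h5 := (hgile i).trans_lt (hv1 i)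
        simp only [Pi.add_apply, Pi.zero_apply] at h1 h2 h3
        constructor
        · have : (((-(r : ℤ) - 1 : ℤ)) : ℝ) ≤ z i := by push_cast; linarith
          exact_mod_cast this
        · have : (z i : ℝ) ≤ ((⌈L⌉ + r + 2 : ℤ) : ℝ) := by
            push_cast; linarith [Int.le_ceil L]
          exact_mod_cast this
      have hnD : n ∈ D := by
        simp only [D, digs, Finset.mem_filter, Finset.mem_range]
        exact ⟨by omega, hnJ⟩
      simp [ext, hzW, hnD]
  · have hW : (W.card : ℝ) ≤ (L + 2 * r + 6) ^ d := by
      simp only [W, Fintype.card_piFinset, Int.card_Icc, Finset.prod_const, Finset.card_univ,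
        Fintype.card_fin]
      push_cast
      gcongr
      have h0 : (0 : ℤ) ≤ ⌈L⌉ + r + 2 + 1 - (-(r : ℤ) - 1) := by
        have : 0 < ⌈L⌉ := Int.ceil_pos.2 hL
        omega
      have h1 : (((⌈L⌉ + r + 2 + 1 - (-(r : ℤ) - 1)).toNat : ℤ) : ℝ) =
          ((⌈L⌉ + r + 2 + 1 - (-(r : ℤ) - 1) : ℤ) : ℝ) := by rw [Int.toNat_of_nonneg h0]
      rw [Int.cast_natCast] at h1
      rw [h1]
      push_cast
      linarith [Int.ceil_lt_add_one L]
    have hcard : (Fintype.card ι : ℝ) = (M : ℝ) ^ d * (2 : ℝ) ^ (W.card * D.card) := by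
      simp [ι]
    rw [hcard, Real.logb_mul (by positivity) (by positivity), Real.logb_pow, Real.logb_pow,
      Real.logb_self_eq_one (by norm_num)]
    push_cast
    have : (0 : ℝ) ≤ D.card := by positivity
    nlinarith [hW]

lemma tendsto_rate (A N c : ℝ) (hd : 0 < d) :
    Tendsto (fun L : ℝ => (A + N * (L + c) ^ d) / L ^ d) atTop (𝓝 N) := by
  have h1 : Tendsto (fun L : ℝ => A / L ^ d) atTop (𝓝 0) :=
    tendsto_const_nhds.div_atTop (tendsto_pow_atTop hd.ne')
  have h2 : Tendsto (fun L : ℝ => 1 + c / L) atTop (𝓝 (1 + 0)) :=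
    tendsto_const_nhds.add (tendsto_const_nhds.div_atTop tendsto_id)
  have h3 := h1.add ((h2.pow d).const_mul N)
  simp only [add_zero, one_pow, mul_one, zero_add] at h3
  refine h3.congr' ?_
  filter_upwards [eventually_gt_atTop 0] with L hL
  rw [show (1 : ℝ) + c / L = (L + c) / L by field_simp, div_pow]
  field_simp

lemma exists_params (m : ℕ) {ε : ℝ} (hε : (2 : ℝ)⁻¹ ^ (m + 1) < ε) :
    ∃ M r : ℕ, 0 < M ∧ ∃ δ < ε, (M : ℝ)⁻¹ + max ((2 : ℝ)⁻¹ ^ (m + 1)) (1 + (r : ℝ))⁻¹ < δ := by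
  have h0 : (0 : ℝ) < (2 : ℝ)⁻¹ ^ (m + 1) := by positivity
  set e := (2 : ℝ)⁻¹ ^ (m + 1) with he
  obtain ⟨r, hr⟩ := exists_nat_gt (1 / e)
  obtain ⟨M, hM⟩ := exists_nat_gt (2 / (ε - e))
  have hpos : 0 < ε - e := by linarith
  have hM0 : (0 : ℝ) < M := lt_trans (by positivity) hM
  refine ⟨M, r, by exact_mod_cast hM0, (ε + e) / 2, by linarith, ?_⟩
  have h1 : (1 + (r : ℝ))⁻¹ ≤ e := by
    rw [inv_le_comm₀ (by positivity) h0, inv_eq_one_div]; linarith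
  rw [max_eq_left h1]
  have h2 : (M : ℝ)⁻¹ < (ε - e) / 2 := by
    rw [inv_lt_comm₀ hM0 (by positivity), inv_div]; exact hM
  linarith

lemma RD_upper (ν : Measure (Spc d J)) [IsProbabilityMeasure ν] (m : ℕ) {ε : ℝ}
    (hε : (2 : ℝ)⁻¹ ^ (m + 1) < ε) : RD d (act J) ν ε ≤ ((digs J m).card : ℝ≥0∞) := by
  obtain ⟨M, r, hM, δ, hδε, hδ⟩ := exists_params m hε
  have hδ0 : 0 ≤ δ := le_trans (by positivity) hδ.le
  have ht := ENNReal.tendsto_ofReal (tendsto_rate (d * Real.logb 2 M) ((digs J m).card : ℝ)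
    (2 * r + 6) (NeZero.pos d))
  rw [ENNReal.ofReal_natCast] at ht
  refine ge_of_tendsto ht ?_
  filter_upwards [eventually_gt_atTop 0] with L hL
  obtain ⟨ι, _, p, hp, hcard⟩ := exists_cover (d := d) J L hL M r m hM δ hδ
  have h1 := (cover_bounds (act J) (act_isContAction J) ν hL hδ0 p hp).1 ε hδε
  unfold RD
  refine iInf_le_of_le L (iInf_le_of_le hL ?_)
  rw [ENNReal.ofReal_div_of_pos (by positivity)]
  gcongr
  refine h1.trans (ENNReal.ofReal_le_ofReal ?_)
  rw [← add_assoc]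
  exact hcard

lemma entScale_upper (ν : Measure (Spc d J)) [IsProbabilityMeasure ν] (m : ℕ) {ε : ℝ}
    (hε : 2 * (2 : ℝ)⁻¹ ^ (m + 1) < ε) :
    entScale d (act (d := d) J) ε ≤ ((digs J m).card : ℝ≥0∞) := by
  obtain ⟨M, r, hM, δ, hδε, hδ⟩ := exists_params m (ε := ε / 2) (by linarith)
  have hδ0 : 0 ≤ δ := le_trans (by positivity) hδ.le
  have ht := ENNReal.tendsto_ofReal (tendsto_rate (d * Real.logb 2 M) ((digs J m).card : ℝ)
    (2 * r + 6) (NeZero.pos d))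
  rw [ENNReal.ofReal_natCast] at ht
  rw [← ht.limsup_eq]
  unfold entScale
  refine limsup_le_limsup ?_
  filter_upwards [eventually_gt_atTop 0] with L hL
  obtain ⟨ι, _, p, hp, hcard⟩ := exists_cover (d := d) J L hL M r m hM δ hδ
  have h1 := (cover_bounds (act J) (act_isContAction J) ν hL hδ0 p hp).2 ε (by linarith)
  refine ENNReal.ofReal_le_ofReal ?_
  gcongr
  rw [← add_assoc]
  refine le_trans ?_ hcard
  rcases Nat.eq_zero_or_pos (covNum (Spc d J) (dSup d (act J) L) ε) with h0 | h0
  · rw [h0]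
    have : (1 : ℝ) ≤ Fintype.card ι := by
      have : Nonempty (Spc d J) := ν.nonempty_of_neZero
      obtain ⟨i, -⟩ := hp (Classical.arbitrary _)
      exact_mod_cast Fintype.card_pos_iff.2 ⟨i⟩
    simp only [CharP.cast_eq_zero, Real.logb_zero]
    exact Real.logb_nonneg (by norm_num) this
  · exact Real.logb_le_logb_of_le (by norm_num) (by exact_mod_cast h0) (by exact_mod_cast h1)

end

/-! ### The measure -/

/-- A fair coin. -/
noncomputable def coin : Measure Bool := (2 : ℝ≥0∞)⁻¹ • (Measure.dirac true + Measure.dirac false)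

instance : IsProbabilityMeasure coin := by
  constructor
  simp only [coin, Measure.smul_apply, Measure.add_apply, measure_univ, smul_eq_mul]
  rw [one_add_one_eq_two]
  exact ENNReal.inv_mul_cancel (by simp) (by simp)

lemma integral_coin (f : Bool → ℝ) : ∫ b, f b ∂coin = (f true + f false) / 2 := by
  rw [coin, integral_smul_measure, integral_add_measure .of_finite .of_finite, integral_dirac,
    integral_dirac]
  simp; ring

/-- Independent fair bits. -/
noncomputable def bitM (d : ℕ) : Measure (Bits d) :=
  Measure.infinitePi fun _ : (Fin d → ℤ) × ℕ => coin

instance (d : ℕ) : IsProbabilityMeasure (bitM d) := by unfold bitM; infer_instance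

instance (d : ℕ) : IsProbabilityMeasure (boxMeasure d 1) := by
  constructor
  rw [boxMeasure, Measure.restrict_apply_univ, volume_unitBox]; simp

lemma bitM_prod (d : ℕ) (s : Finset ((Fin d → ℤ) × ℕ)) (φ : (Fin d → ℤ) × ℕ → Bool → ℝ) :
    ∫ ω, ∏ p ∈ s, φ p (ω p) ∂(bitM d) = ∏ p ∈ s, ((φ p true + φ p false) / 2) := by
  have h := integral_restrict_infinitePi (μ := fun _ : (Fin d → ℤ) × ℕ => coin) (s := s)
    (f := fun y => ∏ p : s, φ p (y p)) (by
      refine Measurable.aestronglyMeasurable ?_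
      refine Finset.measurable_fun_prod _ fun p _ => ?_
      exact (Measurable.of_discrete (f := φ p)).comp (measurable_pi_apply p))
  have h2 := integral_fintype_prod_eq_prod (ι := s) (𝕜 := ℝ) (μ := fun _ => coin)
    (f := fun p => φ p)
  rw [h2] at h
  simp only [integral_coin, Finset.restrict] at h
  rw [← Finset.prod_coe_sort s (fun p => (φ p true + φ p false) / 2), ← h]
  unfold bitM
  congr 1
  ext ω
  rw [← Finset.prod_coe_sort s]

lemma shiftB_measurable (d : ℕ) (k : Fin d → ℤ) : Measurable (shiftB (d := d) k) :=
  measurable_pi_lambda _ fun _ => measurable_pi_apply _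

lemma bitM_shift (d : ℕ) (k : Fin d → ℤ) : (bitM d).map (shiftB k) = bitM d := by
  let e : (Fin d → ℤ) × ℕ ≃ (Fin d → ℤ) × ℕ := (Equiv.addRight (-k)).prodCongr (Equiv.refl ℕ)
  have h := Measure.infinitePi_map_piCongrLeft (μ := fun _ : (Fin d → ℤ) × ℕ => coin) e
  have h2 : (MeasurableEquiv.piCongrLeft (fun _ : (Fin d → ℤ) × ℕ => Bool) e : Bits d → Bits d)
      = shiftB k := by
    ext ω p
    rw [MeasurableEquiv.coe_piCongrLeft]
    have := Equiv.piCongrLeft_apply_apply (P := fun _ : (Fin d → ℤ) × ℕ => Bool) e ω (e.symm p)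
    rw [Equiv.apply_symm_apply] at this
    rw [this]
    simp [shiftB, e]
    rfl
  rw [h2] at h
  exact h

section
variable {d : ℕ} [NeZero d] (J : Set ℕ)

/-- The invariant measure. -/
noncomputable def nu (d : ℕ) [NeZero d] (J : Set ℕ) : Measure (Spc d J) :=
  ((boxMeasure d 1).prod (bitM d)).map fun p => mk J p.1 p.2

lemma mk_measurable : Measurable fun p : (Fin d → ℝ) × Bits d => mk J p.1 p.2 :=
  (mk_continuous J).measurable

instance : IsProbabilityMeasure (nu d J) :=
  Measure.isProbabilityMeasure_map (mk_measurable J).aemeasurable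

lemma nu_apply {A : Set (Spc d J)} (hA : MeasurableSet A) :
    nu d J A = ∫⁻ v in unitBox d 1, bitM d {ω | mk J v ω ∈ A} := by
  rw [nu, Measure.map_apply (mk_measurable J) hA, Measure.prod_apply (mk_measurable J hA)]
  rfl

lemma nu_invariant : MeasInvariant d (act J) (nu d J) := by
  intro u
  have hcont : Continuous (act (d := d) J u) :=
    (act_isContAction J).1.comp (continuous_const.prodMk continuous_id)
  ext A hA
  rw [Measure.map_apply hcont.measurable hA, nu_apply J (hcont.measurable hA), nu_apply J hA]
  let G : (Fin d → ℝ) → ℝ≥0∞ := fun v => bitM d {ω | mk J v ω ∈ A}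
  have h1 : ∀ v, bitM d {ω | mk J v ω ∈ act J u ⁻¹' A} = G (u +ᵥ v) := by
    intro v
    simp only [G, mem_preimage, act_mk, vadd_eq_add, add_comm]
  simp_rw [h1]
  have hper : ∀ (k : Fin d → ℤ) v, G (v + castv k) = G v := by
    intro k v
    simp only [G, mk_shift]
    conv_rhs => rw [← bitM_shift d k]
    rw [Measure.map_apply (shiftB_measurable d k)]
    · rfl
    · exact ((mk_measurable J).comp measurable_prodMk_left) hA
  have hfd := ZSpan.isAddFundamentalDomain' (Pi.basisFun ℝ (Fin d)) (volume : Measure (Fin d → ℝ))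
  have hbox : unitBox d 1 = ZSpan.fundamentalDomain (Pi.basisFun ℝ (Fin d)) := by
    rw [ZSpan.fundamentalDomain_pi_basisFun]; rfl
  have hcount : Countable (Submodule.span ℤ (Set.range (Pi.basisFun ℝ (Fin d)))).toAddSubgroup :=
    inferInstanceAs (Countable (Submodule.span ℤ (Set.range (Pi.basisFun ℝ (Fin d)))))
  have hfd2 := hfd.vadd_of_comm u
  have hmain := hfd.setLIntegral_eq hfd2 G (by
    rintro ⟨g, hg⟩ x
    obtain ⟨k, hk⟩ : ∃ k : Fin d → ℤ, g = castv k := by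
      have hg' : g ∈ Submodule.span ℤ (Set.range (Pi.basisFun ℝ (Fin d))) := hg
      rw [Module.Basis.mem_span_iff_repr_mem] at hg'
      choose k hk using hg'
      exact ⟨k, by ext i; simpa [castv] using (hk i).symm⟩
    subst hk
    change G (castv k + x) = G x
    rw [add_comm, hper])
  rw [hbox]
  change ∫⁻ v in ZSpan.fundamentalDomain (Pi.basisFun ℝ (Fin d)), G (u +ᵥ v) = 
    ∫⁻ v in ZSpan.fundamentalDomain (Pi.basisFun ℝ (Fin d)), G v
  rw [hmain]
  have hmp := measurePreserving_vadd u (volume : Measure (Fin d → ℝ))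
  rw [← Set.image_vadd, ← hmp.setLIntegral_comp_emb (measurableEmbedding_const_vadd u)]
end
end RDExample

open MeasureTheory Filter Set
open scoped ENNReal Topology NNReal

namespace RDExample

/-! ### Elementary estimates -/

lemma sum_weights (k : ℕ) :
    ∑ j ∈ Finset.range k, ((j : ℝ) + 1) * (2 : ℝ)⁻¹ ^ j = 4 - (2 * k + 4) * (2 : ℝ)⁻¹ ^ k := by
  induction k with
  | zero => simp
  | succ k ih => rw [Finset.sum_range_succ, ih]; push_cast; ring

lemma sum_geom (k : ℕ) :
    ∑ j ∈ Finset.range k, (2 : ℝ)⁻¹ ^ (j + 1) = 1 - (2 : ℝ)⁻¹ ^ k := by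
  induction k with
  | zero => simp
  | succ k ih => rw [Finset.sum_range_succ, ih]; ring

lemma digs_le {J : Set ℕ} {m n : ℕ} (h : n ∈ digs J m) : n ≤ m := by
  simp only [digs, Finset.mem_filter, Finset.mem_range] at h; omega

lemma digs_mem {J : Set ℕ} {m n : ℕ} (h : n ∈ digs J m) : n ∈ J := by
  simp only [digs, Finset.mem_filter, Finset.mem_range] at h; exact h.2

lemma sum_digs_le (J : Set ℕ) (m : ℕ) (f : ℕ → ℝ) (hf : ∀ j, 0 ≤ f j) :
    ∑ n ∈ digs J m, f (m - n) ≤ ∑ j ∈ Finset.range (m + 1), f j := by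
  classical
  rw [← Finset.sum_range_reflect]
  simp only [add_tsub_cancel_right]
  exact Finset.sum_le_sum_of_subset_of_nonneg (Finset.filter_subset _ _) fun _ _ _ => hf _

lemma prod_digs_le (J : Set ℕ) (m : ℕ) :
    ∏ n ∈ digs J m, (1 + (2 : ℝ)⁻¹ ^ (m - n + 1)) ≤ 4 := by
  have h1 : ∏ n ∈ digs J m, (1 + (2 : ℝ)⁻¹ ^ (m - n + 1)) ≤
      ∏ n ∈ digs J m, Real.exp ((2 : ℝ)⁻¹ ^ (m - n + 1)) := by
    refine Finset.prod_le_prod (fun _ _ => by positivity) fun n _ => ?_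
    linarith [Real.add_one_le_exp ((2 : ℝ)⁻¹ ^ (m - n + 1))]
  rw [← Real.exp_sum] at h1
  have h2 := sum_digs_le J m (fun j => (2 : ℝ)⁻¹ ^ (j + 1)) (fun _ => by positivity)
  rw [sum_geom] at h2
  have h3 : (0 : ℝ) < (2 : ℝ)⁻¹ ^ (m + 1) := by positivity
  have h4 : Real.exp (∑ n ∈ digs J m, (2 : ℝ)⁻¹ ^ (m - n + 1)) ≤ Real.exp 1 :=
    Real.exp_le_exp.2 (by linarith)
  linarith [Real.exp_one_lt_d9]

lemma one_bit {a₀ a₁ t : ℝ} (h₀ : 0 ≤ a₀) (h₁ : 0 ≤ a₁) (h : t ≤ a₀ + a₁) :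
    (2 : ℝ) ^ (-a₀) + (2 : ℝ) ^ (-a₁) ≤ 1 + (2 : ℝ) ^ (-t) := by
  have h2 : (2 : ℝ) ^ (-a₀) ≤ 1 := Real.rpow_le_one_of_one_le_of_nonpos (by norm_num) (by linarith)
  have h3 : (2 : ℝ) ^ (-a₁) ≤ 1 := Real.rpow_le_one_of_one_le_of_nonpos (by norm_num) (by linarith)
  have h4 : (2 : ℝ) ^ (-a₀) * (2 : ℝ) ^ (-a₁) ≤ (2 : ℝ) ^ (-t) := by
    rw [← Real.rpow_add (by norm_num)]
    exact Real.rpow_le_rpow_of_exponent_le (by norm_num) (by linarith)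
  nlinarith

/-- The weights. -/
noncomputable def wgt (m n : ℕ) : ℝ := ((m - n : ℕ) + 1) * (2 : ℝ)⁻¹ ^ m / 4

lemma wgt_nonneg (m n : ℕ) : 0 ≤ wgt m n := by unfold wgt; positivity

section
variable {d : ℕ} [NeZero d] (J : Set ℕ)

lemma Phi_lower (m : ℕ) (v v' : Fin d → ℝ) (ω ω' : Bits d) :
    ∑ n ∈ digs J m, wgt m n * |FF ω v n - FF ω' v' n| ≤ dist (Phi J v ω) (Phi J v' ω') := by
  set Δ := dist (Phi J v ω) (Phi J v' ω')
  have hΔ : 0 ≤ Δ := dist_nonneg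
  have h1 : ∀ n ∈ digs J m, wgt m n * |FF ω v n - FF ω' v' n| ≤
      (((m - n : ℕ) : ℝ) + 1) * (2 : ℝ)⁻¹ ^ (m - n) * (Δ / 4) := by
    intro n hn
    have h := val_le_Phi J v v' ω ω' ((0, n) : Idx d)
    rw [val_sub J v v' ω ω' ((0, n) : Idx d)] at h
    simp only [norm_zero, add_zero, inv_one, one_mul, cc, digs_mem hn, if_true] at h
    have h2 : (2 : ℝ)⁻¹ ^ m = (2 : ℝ)⁻¹ ^ (m - n) * (2 : ℝ)⁻¹ ^ n := by
      rw [← pow_add, Nat.sub_add_cancel (digs_le hn)]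
    unfold wgt
    rw [h2]
    calc _ = (((m - n : ℕ) : ℝ) + 1) * (2 : ℝ)⁻¹ ^ (m - n) / 4 *
          ((2 : ℝ)⁻¹ ^ n * |FF ω v n - FF ω' v' n|) := by ring
      _ ≤ (((m - n : ℕ) : ℝ) + 1) * (2 : ℝ)⁻¹ ^ (m - n) / 4 * Δ := by gcongr
      _ = _ := by ring
  refine (Finset.sum_le_sum h1).trans ?_
  rw [← Finset.sum_mul]
  have h2 := sum_digs_le J m (fun j => ((j : ℝ) + 1) * (2 : ℝ)⁻¹ ^ j) (fun _ => by positivity)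
  rw [sum_weights] at h2
  have h3 : 0 ≤ (2 * ((m + 1 : ℕ) : ℝ) + 4) * (2 : ℝ)⁻¹ ^ (m + 1) := by positivity
  calc _ ≤ 4 * (Δ / 4) := by gcongr; linarith
    _ = Δ := by ring

lemma FF_continuous (ω : Bits d) (n : ℕ) : Continuous fun v => FF ω v n := by
  refine LipschitzWith.continuous (K := 1) (LipschitzWith.of_dist_le_mul fun v v' => ?_)
  rw [Real.dist_eq]; simpa using FF_sub_le ω v v' n

lemma psi_continuous : Continuous fun v : Fin d → ℝ => psi v := Metric.continuous_infDist_pt _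

/-- The observation set of cell `z`. -/
def Vset (L : ℝ) (v : Fin d → ℝ) (z : Fin d → ℤ) : Set (Fin d → ℝ) :=
  Set.univ.pi fun i => Set.Ico 0 L ∩ Set.Icc (z i + 1 / 8 - v i) (z i + 7 / 8 - v i)

/-- The set of cells that are seen. -/
noncomputable def Sset (L : ℝ) (v : Fin d → ℝ) : Finset (Fin d → ℤ) :=
  Fintype.piFinset fun i => Finset.Ico ⌈v i - 5 / 8⌉ ⌈v i + L - 3 / 8⌉

lemma Vset_measurable (L : ℝ) (v : Fin d → ℝ) (z : Fin d → ℤ) : MeasurableSet (Vset L v z) :=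
  MeasurableSet.univ_pi fun _ => measurableSet_Ico.inter measurableSet_Icc

lemma Vset_subset (L : ℝ) (v : Fin d → ℝ) (z : Fin d → ℤ) : Vset L v z ⊆ unitBox d L :=
  Set.pi_mono fun _ _ => inter_subset_left

lemma Vset_flr {L : ℝ} {v : Fin d → ℝ} {z : Fin d → ℤ} {u : Fin d → ℝ} (hu : u ∈ Vset L v z) :
    flr (v + u) = z := by
  ext i
  have h := (hu i (mem_univ i)).2
  simp only [flr, Pi.add_apply]
  rw [Int.floor_eq_iff]
  constructor <;> linarith [h.1, h.2]

lemma Vset_psi {L : ℝ} {v : Fin d → ℝ} {z : Fin d → ℤ} {u : Fin d → ℝ} (hu : u ∈ Vset L v z) :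
    1 / 8 ≤ psi (v + u) := by
  refine le_psi _ z fun i => ?_
  have h := (hu i (mem_univ i)).2
  simp only [Pi.add_apply]
  rw [abs_le]
  constructor <;> linarith [h.1, h.2]

lemma Vset_disjoint (L : ℝ) (v : Fin d → ℝ) {z z' : Fin d → ℤ} (h : z ≠ z') :
    Disjoint (Vset L v z) (Vset L v z') := by
  rw [Set.disjoint_left]
  intro u hu hu'
  exact h ((Vset_flr hu).symm.trans (Vset_flr hu'))

lemma Vset_volume {L : ℝ} (hL : 0 < L) {v : Fin d → ℝ} {z : Fin d → ℤ} (hz : z ∈ Sset L v) :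
    (min L (1 / 4)) ^ d ≤ volume.real (Vset L v z) := by
  simp only [Sset, Fintype.mem_piFinset, Finset.mem_Ico] at hz
  have hpos : 0 < min L (1 / 4) := lt_min hL (by norm_num)
  have hsub : (Set.univ.pi fun i => Set.Ico (max 0 (z i + 1 / 8 - v i))
      (min L (z i + 7 / 8 - v i))) ⊆ Vset L v z := by
    refine Set.pi_mono fun i _ => ?_
    rintro x ⟨h1, h2⟩
    have h3 := max_le_iff.1 h1
    have h4 := lt_min_iff.1 h2
    exact ⟨⟨h3.1, h4.1⟩, ⟨h3.2, h4.2.le⟩⟩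
  have hfin : volume (Vset L v z) ≠ ⊤ := by
    refine ne_top_of_le_ne_top ?_ (measure_mono (Vset_subset L v z))
    rw [volume_unitBox]; exact ENNReal.pow_ne_top ENNReal.ofReal_ne_top
  have h1 : ENNReal.ofReal ((min L (1 / 4)) ^ d) ≤ volume (Vset L v z) := by
    refine le_trans ?_ (measure_mono hsub)
    rw [volume_pi_pi, ENNReal.ofReal_pow hpos.le]
    have : ENNReal.ofReal (min L (1 / 4)) ^ d =
        ∏ _i : Fin d, ENNReal.ofReal (min L (1 / 4)) := by simp
    rw [this]
    refine Finset.prod_le_prod' fun i _ => ?_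
    rw [Real.volume_Ico]
    refine ENNReal.ofReal_le_ofReal ?_
    have h2 := Int.ceil_le.1 (hz i).1
    have h3 := Int.lt_ceil.1 (hz i).2
    have h4 := min_le_left L (1 / 4)
    have h5 := min_le_right L (1 / 4)
    rw [le_sub_iff_add_le]
    refine le_min ?_ ?_
    · rcases max_cases 0 (z i + 1 / 8 - v i) with ⟨h, -⟩ | ⟨h, -⟩ <;> rw [h] <;> linarith
    · rcases max_cases 0 (z i + 1 / 8 - v i) with ⟨h, -⟩ | ⟨h, -⟩ <;> rw [h] <;> linarith
  rw [measureReal_def]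
  exact (ENNReal.ofReal_le_iff_le_toReal hfin).1 h1

/-- The cost of predicting a bit. -/
noncomputable def cost (L : ℝ) (v vq : Fin d → ℝ) (ωq : Bits d) (p : (Fin d → ℤ) × ℕ)
    (b : Bool) : ℝ :=
  ∫ u in Vset L v p.1, |(if b = true then psi (v + u) else 0) - FF ωq (vq + u) p.2|

lemma cost_nonneg (L : ℝ) (v vq : Fin d → ℝ) (ωq : Bits d) (p : (Fin d → ℤ) × ℕ) (b : Bool) :
    0 ≤ cost L v vq ωq p b := integral_nonneg fun _ => abs_nonneg _

lemma box_integrable (L : ℝ) {f : (Fin d → ℝ) → ℝ} (hf : Continuous f) :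
    IntegrableOn f (unitBox d L) := by
  have : unitBox d L ⊆ Set.univ.pi fun _ => Set.Icc (0 : ℝ) L :=
    Set.pi_mono fun _ _ => Ico_subset_Icc_self
  exact (hf.continuousOn.integrableOn_compact (isCompact_univ_pi fun _ => isCompact_Icc)).mono_set
    this

lemma cost_integrand_continuous (v vq : Fin d → ℝ) (ωq : Bits d) (n : ℕ) (b : Bool) :
    Continuous fun u => |(if b = true then psi (v + u) else 0) - FF ωq (vq + u) n| := by
  refine (Continuous.sub ?_ ?_).abs
  · cases b
    · simpa using continuous_const
    · simp only [if_true]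
      exact psi_continuous.comp (continuous_const.add continuous_id)
  · exact (FF_continuous ωq n).comp (continuous_const.add continuous_id)

lemma cost_add {L : ℝ} (hL : 0 < L) (v vq : Fin d → ℝ) (ωq : Bits d) (p : (Fin d → ℤ) × ℕ)
    (hz : p.1 ∈ Sset L v) :
    (min L (1 / 4)) ^ d / 8 ≤ cost L v vq ωq p false + cost L v vq ωq p true := by
  unfold cost
  have hi : ∀ b : Bool, IntegrableOn
      (fun u => |(if b = true then psi (v + u) else 0) - FF ωq (vq + u) p.2|) (Vset L v p.1) :=
    fun b => (box_integrable L (cost_integrand_continuous v vq ωq p.2 b)).mono_set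
      (Vset_subset L v p.1)
  rw [← integral_add (hi false) (hi true)]
  have hfin : volume (Vset L v p.1) ≠ ⊤ := by
    refine ne_top_of_le_ne_top ?_ (measure_mono (Vset_subset L v p.1))
    rw [volume_unitBox]; exact ENNReal.pow_ne_top ENNReal.ofReal_ne_top
  have h1 : ∫ _u in Vset L v p.1, (1 / 8 : ℝ) ≤ ∫ u in Vset L v p.1,
      (|(if false = true then psi (v + u) else 0) - FF ωq (vq + u) p.2| +
        |(if true = true then psi (v + u) else 0) - FF ωq (vq + u) p.2|) := by
    refine setIntegral_mono_on (integrableOn_const hfin) ((hi false).add (hi true))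
      (Vset_measurable L v p.1) fun u hu => ?_
    have h2 := Vset_psi hu
    simp only [Bool.false_eq_true, if_false, if_true, zero_sub, abs_neg]
    have h3 := le_abs_self (psi (v + u) - FF ωq (vq + u) p.2)
    have h4 := le_abs_self (FF ωq (vq + u) p.2)
    linarith
  refine le_trans ?_ h1
  rw [setIntegral_const, smul_eq_mul]
  linarith [Vset_volume hL hz]

lemma L1dist_lower (L : ℝ) (m : ℕ) (v vq : Fin d → ℝ) (ω ωq : Bits d) :
    ∑ p ∈ Sset L v ×ˢ digs J m, wgt m p.2 * cost L v vq ωq p (ω p) ≤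
      L1dist (orb (act J) (act_isContAction J) L (mk J v ω))
        (orb (act J) (act_isContAction J) L (mk J vq ωq)) := by
  rw [L1dist_orb_orb]
  simp only [act_mk, dist_mk, boxMeasure]
  let f : ℕ → (Fin d → ℝ) → ℝ := fun n u => |FF ω (v + u) n - FF ωq (vq + u) n|
  have hfc : ∀ n, Continuous (f n) := fun n =>
    (((FF_continuous ω n).comp (continuous_const.add continuous_id)).sub
      ((FF_continuous ωq n).comp (continuous_const.add continuous_id))).abs
  have h1 : ∫ u in unitBox d L, ∑ n ∈ digs J m, wgt m n * f n u ≤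
      ∫ u in unitBox d L, dist (Phi J (v + u) ω) (Phi J (vq + u) ωq) := by
    refine integral_mono ?_ ?_ fun u => Phi_lower J m (v + u) (vq + u) ω ωq
    · exact box_integrable L (continuous_finset_sum _ fun n _ => (hfc n).const_mul _)
    · refine box_integrable L ?_
      refine Continuous.dist ?_ ?_
      · exact (Phi_continuous J).comp ((continuous_const.add continuous_id).prodMk continuous_const)
      · exact (Phi_continuous J).comp ((continuous_const.add continuous_id).prodMk continuous_const)
  refine le_trans ?_ h1
  rw [integral_finset_sum _ fun n _ => (box_integrable L (hfc n)).const_mul _]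
  simp_rw [integral_const_mul]
  rw [Finset.sum_product_right]
  refine Finset.sum_le_sum fun n _ => ?_
  simp only
  rw [← Finset.mul_sum]
  refine mul_le_mul_of_nonneg_left ?_ (wgt_nonneg m n)
  have h2 : ∀ z ∈ Sset L v, cost L v vq ωq (z, n) (ω (z, n)) = ∫ u in Vset L v z, f n u := by
    intro z _
    unfold cost
    refine setIntegral_congr_fun (Vset_measurable L v z) fun u hu => ?_
    simp only [f, FF, Vset_flr hu]
  rw [Finset.sum_congr rfl h2]
  rw [← integral_biUnion_finset (Sset L v) (fun z _ => Vset_measurable L v z)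
    (fun z _ z' _ h => Vset_disjoint L v h)
    (fun z _ => (box_integrable L (hfc n)).mono_set (Vset_subset L v z))]
  refine setIntegral_mono_set (box_integrable L (hfc n)) (ae_of_all _ fun u => abs_nonneg _) ?_
  exact (iUnion₂_subset fun z _ => Vset_subset L v z).eventuallyLE

/-- The exponential moment bound for fixed phase. -/
lemma moment_bound {L : ℝ} (hL : 0 < L) (m : ℕ) (v vq : Fin d → ℝ) (ωq : Bits d) :
    ∫ ω, ∏ p ∈ Sset L v ×ˢ digs J m,
      (2 : ℝ) ^ (-(32 * 2 ^ m / (min L (1 / 4)) ^ d * (wgt m p.2 * cost L v vq ωq p (ω p))))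
      ∂(bitM d) ≤ (2 : ℝ) ^ (-(((Sset L v).card : ℝ) * ((digs J m).card - 2))) := by
  have hℓ : 0 < (min L (1 / 4)) ^ d := pow_pos (lt_min hL (by norm_num)) d
  set s : ℝ := 32 * 2 ^ m / (min L (1 / 4)) ^ d with hs
  have hs0 : 0 < s := by positivity
  rw [bitM_prod d (Sset L v ×ˢ digs J m)
    (fun p b => (2 : ℝ) ^ (-(s * (wgt m p.2 * cost L v vq ωq p b))))]
  have h1 : ∏ p ∈ Sset L v ×ˢ digs J m,
      (((2 : ℝ) ^ (-(s * (wgt m p.2 * cost L v vq ωq p true))) +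
        (2 : ℝ) ^ (-(s * (wgt m p.2 * cost L v vq ωq p false)))) / 2) ≤
      ∏ p ∈ Sset L v ×ˢ digs J m, ((1 + (2 : ℝ)⁻¹ ^ (m - p.2 + 1)) / 2) := by
    refine Finset.prod_le_prod (fun _ _ => by positivity) fun p hp => ?_
    rw [Finset.mem_product] at hp
    have h2 := cost_add hL v vq ωq p hp.1
    have hw : s * wgt m p.2 * ((min L (1 / 4)) ^ d / 8) = ((m - p.2 + 1 : ℕ) : ℝ) := by
      rw [hs, wgt, inv_pow]
      push_cast
      field_simp
      ring
    have h3 : (2 : ℝ)⁻¹ ^ (m - p.2 + 1) = (2 : ℝ) ^ (-((m - p.2 + 1 : ℕ) : ℝ)) := by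
      rw [Real.rpow_neg (by norm_num), Real.rpow_natCast, inv_pow]
    rw [h3]
    have hc := cost_nonneg L v vq ωq p
    have hwn := wgt_nonneg m p.2
    have := one_bit (a₀ := s * (wgt m p.2 * cost L v vq ωq p true))
      (a₁ := s * (wgt m p.2 * cost L v vq ωq p false)) (t := ((m - p.2 + 1 : ℕ) : ℝ))
      (mul_nonneg hs0.le (mul_nonneg hwn (hc true)))
      (mul_nonneg hs0.le (mul_nonneg hwn (hc false))) (by
        rw [← hw]
        calc _ ≤ s * wgt m p.2 * (cost L v vq ωq p false + cost L v vq ωq p true) := by gcongr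
          _ = _ := by ring)
    linarith
  refine h1.trans ?_
  rw [Finset.prod_product]
  simp only [Finset.prod_const]
  have h4 : ∏ n ∈ digs J m, ((1 + (2 : ℝ)⁻¹ ^ (m - n + 1)) / 2) ≤
      (2 : ℝ) ^ (-(((digs J m).card : ℝ) - 2)) := by
    rw [Finset.prod_div_distrib, Finset.prod_const, div_le_iff₀ (by positivity)]
    refine (prod_digs_le J m).trans ?_
    rw [← Real.rpow_natCast 2 (digs J m).card, ← Real.rpow_add (by norm_num)]
    have : -(((digs J m).card : ℝ) - 2) + (digs J m).card = (2 : ℕ) := by push_cast; ring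
    rw [this, Real.rpow_natCast]; norm_num
  refine (pow_le_pow_left₀ (Finset.prod_nonneg fun _ _ => by positivity) h4 _).trans ?_
  rw [← Real.rpow_natCast, ← Real.rpow_mul (by norm_num)]
  refine le_of_eq ?_
  congr 1; ring

end
end RDExample

open MeasureTheory Filter Set
open scoped ENNReal Topology NNReal

namespace RDExample

/-- The number of visible cells in one coordinate. -/
noncomputable def cnt (L t : ℝ) : ℝ := (⌈t + L - 3 / 8⌉ : ℝ) - ⌈t - 5 / 8⌉

lemma cnt_measurable (L : ℝ) : Measurable (cnt L) := by
  unfold cnt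
  have h : Measurable fun n : ℤ => (n : ℝ) := Measurable.of_discrete
  exact (h.comp (Int.measurable_ceil.comp (by fun_prop))).sub
    (h.comp (Int.measurable_ceil.comp (by fun_prop)))

lemma cnt_nonneg {L : ℝ} (hL : 0 < L) (t : ℝ) : 0 ≤ cnt L t := by
  unfold cnt
  have : ⌈t - 5 / 8⌉ ≤ ⌈t + L - 3 / 8⌉ := Int.ceil_mono (by linarith)
  have h : (⌈t - 5 / 8⌉ : ℝ) ≤ ⌈t + L - 3 / 8⌉ := by exact_mod_cast this
  linarith

lemma cnt_le (L t : ℝ) : cnt L t ≤ L + 2 := by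
  unfold cnt
  linarith [Int.ceil_lt_add_one (t + L - 3 / 8), Int.le_ceil (t - 5 / 8)]

lemma ceil_eq (x : ℝ) : (⌈x⌉ : ℝ) = x + Int.fract (-x) := by
  rw [Int.fract, Int.floor_neg]; push_cast; ring

lemma fract_periodic : Function.Periodic (fun t : ℝ => Int.fract (-t)) 1 := by
  intro t
  simp only
  rw [neg_add, ← sub_eq_add_neg, Int.fract_sub_one]

lemma fract_integrable (c : ℝ) : IntervalIntegrable (fun t : ℝ => Int.fract (-(t + c))) volume 0 1 := by
  rw [intervalIntegrable_iff_integrableOn_Ico_of_le zero_le_one]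
  refine Integrable.of_bound (C := 1) ?_ (ae_of_all _ fun t => ?_)
  · exact (measurable_fract.comp (by fun_prop)).aestronglyMeasurable
  · rw [Real.norm_of_nonneg (Int.fract_nonneg _)]; exact (Int.fract_lt_one _).le

lemma fract_integral (c : ℝ) : ∫ t in (0 : ℝ)..1, Int.fract (-(t + c)) =
    ∫ t in (0 : ℝ)..1, Int.fract (-t) := by
  rw [intervalIntegral.integral_comp_add_right (fun t => Int.fract (-t)) c]
  have := fract_periodic.intervalIntegral_add_eq (0 + c) 0
  simpa [add_comm] using this

lemma cnt_integral (L : ℝ) : ∫ t in Set.Ico (0 : ℝ) 1, cnt L t = L + 1 / 4 := by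
  rw [integral_Ico_eq_integral_Ioc, ← intervalIntegral.integral_of_le zero_le_one]
  have h : ∀ t, cnt L t = (L + 1 / 4) + (Int.fract (-(t + (L - 3 / 8))) -
      Int.fract (-(t + (-5 / 8)))) := by
    intro t
    unfold cnt
    rw [ceil_eq, ceil_eq, show t + L - 3 / 8 = t + (L - 3 / 8) by ring,
      show t - 5 / 8 = t + (-5 / 8) by ring]
    ring
  simp_rw [h]
  rw [intervalIntegral.integral_add (by simp) ((fract_integrable _).sub (fract_integrable _)),
    intervalIntegral.integral_sub (fract_integrable _) (fract_integrable _), fract_integral,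
    fract_integral]
  simp

section
variable {d : ℕ} [NeZero d] (J : Set ℕ)

lemma box_prod_integral (L : ℝ) :
    ∫ v, ∏ i, cnt L (v i) ∂(boxMeasure d 1) = (L + 1 / 4) ^ d := by
  have h : boxMeasure d 1 = Measure.pi fun _ : Fin d => volume.restrict (Set.Ico (0 : ℝ) 1) := by
    rw [boxMeasure, unitBox, volume_pi, Measure.restrict_pi_pi]
  rw [h, integral_fintype_prod_eq_prod (𝕜 := ℝ) (f := fun _ => cnt L)]
  simp [cnt_integral]

lemma Sset_card {L : ℝ} (hL : 0 < L) (v : Fin d → ℝ) :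
    ((Sset L v).card : ℝ) = ∏ i, cnt L (v i) := by
  simp only [Sset, Fintype.card_piFinset, Int.card_Ico]
  push_cast
  refine Finset.prod_congr rfl fun i _ => ?_
  have h := cnt_nonneg hL (v i)
  unfold cnt at h ⊢
  have h0 : (0 : ℤ) ≤ ⌈v i + L - 3 / 8⌉ - ⌈v i - 5 / 8⌉ := by exact_mod_cast h
  have h1 : (((⌈v i + L - 3 / 8⌉ - ⌈v i - 5 / 8⌉).toNat : ℤ) : ℝ) =
      ((⌈v i + L - 3 / 8⌉ - ⌈v i - 5 / 8⌉ : ℤ) : ℝ) := by rw [Int.toNat_of_nonneg h0]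
  rw [Int.cast_natCast] at h1
  rw [h1]; push_cast; ring

/-- The phase of a point. -/
noncomputable def theta (x : Spc d J) : Fin d → ℝ := fun i =>
  (AddCircle.equivIco (1 : ℝ) 0 (x.1.1 i) : ℝ)

lemma theta_measurable : Measurable (theta (d := d) J) := by
  refine measurable_pi_lambda _ fun i => ?_
  have h1 : Continuous fun x : Spc d J => x.1.1 i :=
    (continuous_apply i).comp (continuous_fst.comp continuous_subtype_val)
  have h2 : Measurable fun z : UnitAddCircle => (AddCircle.equivIco (1 : ℝ) 0 z : ℝ) :=
    measurable_subtype_coe.comp (AddCircle.measurableEquivIco (1 : ℝ) 0).measurable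
  exact h2.comp h1.measurable

lemma theta_mk {v : Fin d → ℝ} (hv : v ∈ unitBox d 1) (ω : Bits d) : theta J (mk J v ω) = v := by
  ext i
  have h : v i ∈ Set.Ico (0 : ℝ) (0 + 1) := by simpa using hv i (mem_univ i)
  change (AddCircle.equivIco (1 : ℝ) 0 ((v i : ℝ) : AddCircle (1 : ℝ)) : ℝ) = v i
  rw [AddCircle.equivIco_coe_eq h]

lemma RL_nu_lower {L : ℝ} (hL : 0 < L) (m : ℕ) :
    ENNReal.ofReal ((L + 1 / 4) ^ d * ((digs J m).card - 2) -
      32 * 2 ^ m / (min L (1 / 4)) ^ d * (3 * (2 : ℝ)⁻¹ ^ m * L ^ d)) ≤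
    RL d (act J) (nu d J) L ((2 : ℝ)⁻¹ ^ m) := by
  have hℓ : 0 < (min L (1 / 4)) ^ d := pow_pos (lt_min hL (by norm_num)) d
  set s : ℝ := 32 * 2 ^ m / (min L (1 / 4)) ^ d with hs
  have hs0 : 0 < s := by positivity
  set N : ℝ := ((digs J m).card : ℝ) with hN
  let H : (Fin d → ℝ) → ℝ := fun v => (∏ i, cnt L (v i)) * (N - 2)
  have hHm : Measurable H := by
    refine Measurable.mul_const (Finset.measurable_fun_prod _ fun i _ => ?_) _
    exact (cnt_measurable L).comp (measurable_pi_apply i)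
  have hHC : ∀ v, |H v| ≤ (L + 2) ^ d * |N - 2| := by
    intro v
    simp only [H]
    rw [abs_mul, abs_of_nonneg (Finset.prod_nonneg fun i _ => cnt_nonneg hL _)]
    gcongr
    refine (Finset.prod_le_prod (fun i _ => cnt_nonneg hL _) fun i _ => cnt_le L (v i)).trans ?_
    simp
  have hT := act_isContAction (d := d) J
  have hint : ∫ x, H (theta J x) ∂(nu d J) = (L + 1 / 4) ^ d * (N - 2) := by
    have hmeas : Measurable fun x : Spc d J => H (theta J x) := hHm.comp (theta_measurable J)
    rw [nu, integral_map (mk_measurable J).aemeasurable hmeas.aestronglyMeasurable,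
      integral_prod]
    · have : ∀ᵐ v ∂(boxMeasure d 1), ∫ ω, H (theta J (mk J v ω)) ∂(bitM d) = H v := by
        filter_upwards [ae_restrict_mem (unitBox_measurable d 1)] with v hv
        simp [theta_mk J hv]
      simp only
      rw [integral_congr_ae this]
      simp only [H]
      rw [integral_mul_const, box_prod_integral]
    · refine Integrable.of_bound (C := (L + 2) ^ d * |N - 2|)
        (hmeas.comp (mk_measurable J)).aestronglyMeasurable (ae_of_all _ fun p => hHC _)
  rw [← hint]
  refine RL_lower (act J) hT (nu d J) hL hs0.le (by positivity) (fun x => H (theta J x))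
    (hHm.comp (theta_measurable J)) (fun x => hHC _) ?_
  intro q
  obtain ⟨vq, ωq, rfl⟩ := exists_mk J q
  set ρ : Spc d J → ℝ := fun x =>
    L1dist (orb (act J) hT L x) (orb (act J) hT L (mk J vq ωq)) with hρ
  have hgm : Measurable fun x : Spc d J => (2 : ℝ) ^ (H (theta J x) - s * ρ x) :=
    ((hHm.comp (theta_measurable J)).sub
      ((L1dist_orb_continuous (act J) hT _).measurable.const_mul s)).const_pow 2
  have hgb : ∀ x, (2 : ℝ) ^ (H (theta J x) - s * ρ x) ≤ (2 : ℝ) ^ ((L + 2) ^ d * |N - 2|) := by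
    intro x
    refine Real.rpow_le_rpow_of_exponent_le (by norm_num) ?_
    have h1 := (le_abs_self _).trans (hHC (theta J x))
    have h2 : 0 ≤ s * ρ x := mul_nonneg hs0.le (L1dist_nonneg _ _)
    linarith
  have hgi : Integrable (fun p : (Fin d → ℝ) × Bits d =>
      (2 : ℝ) ^ (H (theta J (mk J p.1 p.2)) - s * ρ (mk J p.1 p.2)))
      ((boxMeasure d 1).prod (bitM d)) := by
    refine Integrable.of_bound (C := (2 : ℝ) ^ ((L + 2) ^ d * |N - 2|))
      (hgm.comp (mk_measurable J)).aestronglyMeasurable (ae_of_all _ fun p => ?_)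
    rw [Real.norm_of_nonneg (by positivity)]
    exact hgb _
  rw [nu, integral_map (mk_measurable J).aemeasurable hgm.aestronglyMeasurable,
    integral_prod _ hgi]
  have hmain : ∀ᵐ v ∂(boxMeasure d 1), ∫ ω, (2 : ℝ) ^ (H (theta J (mk J v ω)) -
      s * ρ (mk J v ω)) ∂(bitM d) ≤ 1 := by
    filter_upwards [ae_restrict_mem (unitBox_measurable d 1)] with v hv
    have hH : H v = (Sset L v).card * (N - 2) := by simp only [H]; rw [Sset_card hL]
    have hb := moment_bound J hL m v vq ωq
    rw [← hs] at hb
    have hpt : ∀ ω, (2 : ℝ) ^ (H (theta J (mk J v ω)) - s * ρ (mk J v ω)) ≤ (2 : ℝ) ^ (H v) *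
        ∏ p ∈ Sset L v ×ˢ digs J m,
          (2 : ℝ) ^ (-(s * (wgt m p.2 * cost L v vq ωq p (ω p)))) := by
      intro ω
      rw [theta_mk J hv, ← Real.rpow_sum_of_pos (by norm_num), ← Real.rpow_add (by norm_num)]
      refine Real.rpow_le_rpow_of_exponent_le (by norm_num) ?_
      rw [Finset.sum_neg_distrib, ← Finset.mul_sum, ← sub_eq_add_neg]
      have := L1dist_lower J L m v vq ω ωq
      gcongr
    have hpm : Integrable (fun ω : Bits d => (2 : ℝ) ^ (H v) *
        ∏ p ∈ Sset L v ×ˢ digs J m,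
          (2 : ℝ) ^ (-(s * (wgt m p.2 * cost L v vq ωq p (ω p))))) (bitM d) := by
      refine Integrable.of_bound (C := (2 : ℝ) ^ (H v) * 1) ?_ (ae_of_all _ fun ω => ?_)
      · refine (Measurable.const_mul (Finset.measurable_fun_prod _ fun p _ => ?_) _).aestronglyMeasurable
        exact (Measurable.of_discrete (f := fun b : Bool =>
          (2 : ℝ) ^ (-(s * (wgt m p.2 * cost L v vq ωq p b))))).comp (measurable_pi_apply p)
      · rw [Real.norm_of_nonneg (by positivity)]
        gcongr
        refine Finset.prod_le_one (fun _ _ => by positivity) fun p _ => ?_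
        refine Real.rpow_le_one_of_one_le_of_nonpos (by norm_num) ?_
        have := mul_nonneg hs0.le (mul_nonneg (wgt_nonneg m p.2) (cost_nonneg L v vq ωq p (ω p)))
        linarith
    refine (integral_mono_of_nonneg (ae_of_all _ fun ω => by positivity) hpm
      (ae_of_all _ hpt)).trans ?_
    rw [integral_const_mul]
    calc _ ≤ (2 : ℝ) ^ (H v) * (2 : ℝ) ^ (-(((Sset L v).card : ℝ) * (N - 2))) := by gcongr
      _ = 1 := by rw [← Real.rpow_add (by norm_num), hH]; simp
  refine (integral_mono_of_nonneg (ae_of_all _ fun v => integral_nonneg fun ω => by positivity)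
    (integrable_const 1) hmain).trans ?_
  simp

lemma RD_lower (m : ℕ) :
    ENNReal.ofReal ((digs J m).card - (2 + 96 * 4 ^ d)) ≤
      RD d (act J) (nu d J) ((2 : ℝ)⁻¹ ^ m) := by
  set N : ℝ := ((digs J m).card : ℝ) with hN
  rcases le_or_gt N (2 + 96 * 4 ^ d) with h | h
  · rw [ENNReal.ofReal_of_nonpos (by linarith)]; exact zero_le
  unfold RD
  refine le_iInf fun L => le_iInf fun hL => ?_
  have hLd : 0 < L ^ d := by positivity
  rw [ENNReal.le_div_iff_mul_le (by simp [hLd]) (by simp), ← ENNReal.ofReal_mul (by linarith)]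
  refine le_trans (ENNReal.ofReal_le_ofReal ?_) (RL_nu_lower J hL m)
  have hmin : 0 < min L (1 / 4) := lt_min hL (by norm_num)
  have h1 : 32 * 2 ^ m / (min L (1 / 4)) ^ d * (3 * (2 : ℝ)⁻¹ ^ m * L ^ d) =
      96 * (L / min L (1 / 4)) ^ d := by
    rw [div_pow, inv_pow]; field_simp; ring
  have h2 : L / min L (1 / 4) ≤ 4 * (L + 1 / 4) := by
    rw [div_le_iff₀ hmin]
    rcases min_cases L (1 / 4) with ⟨h3, h4⟩ | ⟨h3, h4⟩ <;> rw [h3] <;> nlinarith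
  have h3 : (L / min L (1 / 4)) ^ d ≤ 4 ^ d * (L + 1 / 4) ^ d := by
    rw [← mul_pow]
    exact pow_le_pow_left₀ (by positivity) h2 d
  rw [h1]
  have h4 : L ^ d ≤ (L + 1 / 4) ^ d := pow_le_pow_left₀ hL.le (by linarith) d
  rw [← hN]
  have h5 : (N - (2 + 96 * 4 ^ d)) * L ^ d ≤ (N - (2 + 96 * 4 ^ d)) * (L + 1 / 4) ^ d :=
    mul_le_mul_of_nonneg_left h4 (by linarith)
  nlinarith

end
end RDExample

open MeasureTheory Filter Set
open scoped ENNReal Topology NNReal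

namespace RDExample

lemma digs_card_le (J : Set ℕ) (m : ℕ) : (digs J m).card ≤ m + 1 := by
  classical
  have h : digs J m ⊆ Finset.range (m + 1) := fun n hn => by
    have := digs_le hn
    rw [Finset.mem_range]; omega
  simpa using Finset.card_le_card h

lemma rpow_neg_lt {t : ℝ} {m : ℕ} (h : t < m) : (2 : ℝ)⁻¹ ^ m < (2 : ℝ) ^ (-t) := by
  rw [inv_pow, ← Real.rpow_natCast, ← Real.rpow_neg (by norm_num)]
  exact Real.rpow_lt_rpow_of_exponent_lt (by norm_num) (by linarith)

lemma eq_rpow_logb {ε : ℝ} (h : 0 < ε) : ε = (2 : ℝ) ^ (-(Real.logb 2 (1 / ε))) := by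
  rw [one_div, Real.logb_inv, neg_neg, Real.rpow_logb (by norm_num) (by norm_num) h]

lemma tendsto_logb_inv :
    Tendsto (fun ε : ℝ => Real.logb 2 (1 / ε)) (𝓝[>] (0 : ℝ)) atTop := by
  have h1 : Tendsto (fun ε : ℝ => 1 / ε) (𝓝[>] (0 : ℝ)) atTop := by
    simpa using tendsto_inv_nhdsGT_zero (𝕜 := ℝ)
  exact (Real.tendsto_logb_atTop (by norm_num)).comp h1

section
variable {d : ℕ} [NeZero d] (J : Set ℕ)

lemma RD_le_floor (ν : Measure (Spc d J)) [IsProbabilityMeasure ν] {t : ℝ} :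
    RD d (act J) ν ((2 : ℝ) ^ (-t)) ≤ ((digs J ⌊t⌋₊).card : ℝ≥0∞) := by
  refine RD_upper J ν _ (rpow_neg_lt ?_)
  push_cast
  exact Nat.lt_floor_add_one t

lemma umdim_ne_top : umdim d (act (d := d) J) ≠ ⊤ := by
  have key : umdim d (act (d := d) J) ≤ 3 := by
    unfold umdim
    refine limsup_le_of_le (by isBoundedDefault) ?_
    filter_upwards [self_mem_nhdsWithin, tendsto_logb_inv.eventually_ge_atTop 1] with ε hε ht
    have hε' : 0 < ε := hε
    set t := Real.logb 2 (1 / ε) with htdef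
    have hεt := eq_rpow_logb hε'
    have hfl : (⌊t⌋₊ : ℝ) ≤ t := Nat.floor_le (by linarith)
    have h1 : entScale d (act (d := d) J) ε ≤ ((digs J (⌊t⌋₊ + 1)).card : ℝ≥0∞) := by
      refine entScale_upper J (nu d J) _ ?_
      rw [hεt, ← htdef]
      have := rpow_neg_lt (t := t) (m := ⌊t⌋₊ + 1) (by push_cast; exact Nat.lt_floor_add_one t)
      refine lt_of_le_of_lt (le_of_eq ?_) this
      rw [pow_succ (2 : ℝ)⁻¹ (⌊t⌋₊ + 1)]; ring
    rw [ENNReal.div_le_iff (by simp; linarith) (by simp)]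
    refine h1.trans ?_
    have h2 : ((digs J (⌊t⌋₊ + 1)).card : ℝ) ≤ 3 * t := by
      have := digs_card_le J (⌊t⌋₊ + 1)
      have h3 : ((digs J (⌊t⌋₊ + 1)).card : ℝ) ≤ ((⌊t⌋₊ + 1 + 1 : ℕ) : ℝ) := by exact_mod_cast this
      push_cast at h3; linarith
    rw [← ENNReal.ofReal_natCast, show (3 : ℝ≥0∞) = ENNReal.ofReal 3 by simp,
      ← ENNReal.ofReal_mul (by norm_num)]
    exact ENNReal.ofReal_le_ofReal h2
  exact ne_top_of_le_ne_top (by simp) key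

lemma urdim_le_one : urdim d (act J) (nu d J) ≤ 1 := by
  have hlim : Tendsto (fun ε : ℝ => ENNReal.ofReal (1 + (Real.logb 2 (1 / ε))⁻¹))
      (𝓝[>] (0 : ℝ)) (𝓝 1) := by
    have h := (tendsto_inv_atTop_zero.comp tendsto_logb_inv).const_add (1 : ℝ)
    have h2 := ENNReal.tendsto_ofReal h
    simpa using h2
  unfold urdim
  rw [← hlim.limsup_eq]
  refine limsup_le_limsup ?_ (by isBoundedDefault) (by isBoundedDefault)
  filter_upwards [self_mem_nhdsWithin, tendsto_logb_inv.eventually_ge_atTop 1] with ε hε ht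
  have hε' : 0 < ε := hε
  set t := Real.logb 2 (1 / ε) with htdef
  have hεt := eq_rpow_logb hε'
  have hfl : (⌊t⌋₊ : ℝ) ≤ t := Nat.floor_le (by linarith)
  have h1 := RD_le_floor J (nu d J) (t := t)
  rw [htdef, ← hεt, ← htdef] at h1
  rw [ENNReal.div_le_iff (by simp; linarith) (by simp), ← ENNReal.ofReal_mul (by positivity)]
  refine h1.trans ?_
  rw [← ENNReal.ofReal_natCast]
  refine ENNReal.ofReal_le_ofReal ?_
  have h3 : ((digs J ⌊t⌋₊).card : ℝ) ≤ ((⌊t⌋₊ + 1 : ℕ) : ℝ) := by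
    exact_mod_cast digs_card_le J ⌊t⌋₊
  push_cast at h3
  have h4 : (1 + t⁻¹) * t = t + 1 := by
    have : t ≠ 0 := by linarith
    field_simp
  linarith

lemma one_le_urdim (s : ℕ → ℕ) (hs : ∀ k, 2 ≤ k → 1 ≤ s k)
    (hJ : ∀ k, 2 ≤ k → ∀ n, s k ≤ n → n < k * s k → n ∈ J) :
    1 ≤ urdim d (act J) (nu d J) := by
  set C : ℝ := 2 + 96 * 4 ^ d with hC
  have hC0 : 0 < C := by positivity
  have hlim : Tendsto (fun k : ℕ => ENNReal.ofReal (1 - (1 + C) * (k : ℝ)⁻¹)) atTop (𝓝 1) := by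
    have h := ((tendsto_inv_atTop_nhds_zero_nat (𝕜 := ℝ)).const_mul (1 + C)).const_sub (1 : ℝ)
    have h2 := ENNReal.tendsto_ofReal h
    simpa using h2
  have hu : Tendsto (fun k : ℕ => (2 : ℝ)⁻¹ ^ (k * s k)) atTop (𝓝[>] (0 : ℝ)) := by
    refine tendsto_nhdsWithin_iff.2 ⟨?_, Eventually.of_forall fun k => ?_⟩
    · refine (tendsto_pow_atTop_nhds_zero_of_lt_one (r := (2 : ℝ)⁻¹)
        (by norm_num) (by norm_num)).comp ?_
      refine tendsto_atTop_mono' atTop ?_ tendsto_id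
      filter_upwards [eventually_ge_atTop 2] with k hk
      exact Nat.le_mul_of_pos_right _ (hs k hk)
    · exact pow_pos (by norm_num : (0 : ℝ) < 2⁻¹) _
  have hle : limsup (fun k : ℕ => RD d (act J) (nu d J) ((2 : ℝ)⁻¹ ^ (k * s k)) /
      ENNReal.ofReal (Real.logb 2 (1 / (2 : ℝ)⁻¹ ^ (k * s k)))) atTop
      ≤ urdim d (act J) (nu d J) := by
    unfold urdim
    have := limsup_le_limsup_of_le hu (f := map (fun k : ℕ => (2 : ℝ)⁻¹ ^ (k * s k)) atTop)
      (u := fun ε : ℝ => RD d (act J) (nu d J) ε / ENNReal.ofReal (Real.logb 2 (1 / ε)))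
      (by isBoundedDefault) (by isBoundedDefault)
    exact this
  refine le_trans ?_ hle
  rw [← hlim.limsup_eq]
  refine limsup_le_limsup ?_ (by isBoundedDefault) (by isBoundedDefault)
  filter_upwards [eventually_ge_atTop 2] with k hk
  have hk0 : (2 : ℝ) ≤ k := by exact_mod_cast hk
  have hs1 : (1 : ℝ) ≤ s k := by exact_mod_cast hs k hk
  have hlog : Real.logb 2 (1 / (2 : ℝ)⁻¹ ^ (k * s k)) = k * s k := by
    rw [one_div, ← inv_pow, inv_inv, Real.logb_pow, Real.logb_self_eq_one (by norm_num)]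
    push_cast; ring
  rw [hlog]
  have hpos : (0 : ℝ) < k * s k := by positivity
  rw [ENNReal.le_div_iff_mul_le (Or.inl (ENNReal.ofReal_pos.2 hpos).ne')
    (Or.inl ENNReal.ofReal_ne_top)]
  refine le_trans ?_ (RD_lower J (k * s k))
  rw [← ENNReal.ofReal_mul' hpos.le]
  refine ENNReal.ofReal_le_ofReal ?_
  have hcard : k * s k - s k ≤ (digs J (k * s k)).card := by
    rw [← Nat.card_Ico]
    refine Finset.card_le_card fun n hn => ?_
    rw [Finset.mem_Ico] at hn
    simp only [digs, Finset.mem_filter, Finset.mem_range]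
    exact ⟨by omega, hJ k hk n hn.1 hn.2⟩
  have hcard2 : (k * s k : ℝ) ≤ (digs J (k * s k)).card + s k := by
    have : k * s k ≤ (digs J (k * s k)).card + s k := by omega
    exact_mod_cast this
  have h5 : (1 - (1 + C) * (k : ℝ)⁻¹) * (k * s k) = k * s k - (1 + C) * s k := by
    field_simp
  rw [h5]
  nlinarith

lemma decay (a b : ℕ → ℕ) (hab : ∀ k, 1 ≤ k → a k < b k ∧ b k < a (k + 1) ∧ k ^ 2 * a k < b k)
    (hJ : ∀ n ∈ J, ∃ k, 1 ≤ k ∧ a k ≤ n ∧ n < k * a k) :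
    Filter.Tendsto (fun t : ℝ => RD d (act J) (nu d J) ((2 : ℝ) ^ (-t)) / ENNReal.ofReal t)
        (Filter.atTop ⊓ Filter.principal
          {t : ℝ | ∃ k, 1 ≤ k ∧ (b k : ℝ) ≤ t ∧ t < (a (k + 1) : ℝ)})
        (nhds 0) := by
  have hmono : ∀ i j, 1 ≤ i → i ≤ j → a i ≤ a j := by
    intro i j hi hij
    induction j, hij using Nat.le_induction with
    | base => exact le_rfl
    | succ n hn ih => have := hab n (by omega); omega
  rw [ENNReal.tendsto_nhds_zero]
  intro ε hε
  obtain ⟨K, hK⟩ := ENNReal.exists_inv_nat_lt hε.ne'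
  rw [eventually_inf_principal]
  filter_upwards [eventually_ge_atTop ((a (K + 1) : ℝ)), eventually_ge_atTop (1 : ℝ)]
    with t ht ht1
  rintro ⟨k, hk, hbt, hta⟩
  have hKk : K < k := by
    by_contra hcon
    have h1 := hmono (k + 1) (K + 1) (by omega) (by omega)
    have h2 : (a (k + 1) : ℝ) ≤ a (K + 1) := by exact_mod_cast h1
    linarith
  have hk0 : (0 : ℝ) < k := by exact_mod_cast hk
  refine le_trans ?_ hK.le
  refine le_trans ?_ (ENNReal.inv_le_inv.2 (Nat.cast_le.2 hKk.le) : (k : ℝ≥0∞)⁻¹ ≤ (K : ℝ≥0∞)⁻¹)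
  rw [ENNReal.div_le_iff (by simp; linarith) (by simp)]
  refine (RD_le_floor J (nu d J)).trans ?_
  have hfl : ⌊t⌋₊ < a (k + 1) := by
    rw [Nat.floor_lt (by linarith)]; exact hta
  have hcard : (digs J ⌊t⌋₊).card ≤ k * a k := by
    rw [← Finset.card_range (k * a k)]
    refine Finset.card_le_card fun n hn => ?_
    have hnm := digs_le hn
    obtain ⟨k', hk', h1, h2⟩ := hJ n (digs_mem hn)
    have hk'k : k' ≤ k := by
      by_contra hcon
      have := hmono (k + 1) k' (by omega) (by omega)
      omega
    rw [Finset.mem_range]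
    exact h2.trans_le (Nat.mul_le_mul hk'k (hmono _ _ hk' hk'k))
  have hreal : ((digs J ⌊t⌋₊).card : ℝ) ≤ (k : ℝ)⁻¹ * t := by
    have h1 : ((digs J ⌊t⌋₊).card : ℝ) ≤ k * a k := by exact_mod_cast hcard
    have h2 : (k : ℝ) ^ 2 * a k ≤ b k := by exact_mod_cast (hab k hk).2.2.le
    refine h1.trans ?_
    rw [inv_mul_eq_div, le_div_iff₀ hk0]
    nlinarith
  rw [← ENNReal.ofReal_natCast, ← ENNReal.ofReal_natCast, ← ENNReal.ofReal_inv_of_pos hk0,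
    ← ENNReal.ofReal_mul (by positivity)]
  exact ENNReal.ofReal_le_ofReal hreal

end
end RDExample

/-- Proposition 5.2: an action of finite upper metric mean dimension with an invariant measure
of upper rate distortion dimension `1` whose rate distortion function is `o(t)` along the
sparse set of scales `t ∈ ⋃ₖ [bₖ, aₖ₊₁)`. -/
theorem exists_action_urdim_one_sparse_decay (d : ℕ) (hd : 0 < d)
    (a b : ℕ → ℕ) (hab : ∀ k, 1 ≤ k → a k < b k ∧ b k < a (k + 1) ∧ k ^ 2 * a k < b k) :
    ∃ (X : Type) (_ : MetricSpace X) (_ : CompactSpace X)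
      (_ : MeasurableSpace X) (_ : BorelSpace X) (T : (Fin d → ℝ) → X → X)
      (ν : Measure X),
      IsContAction d T ∧ IsProbabilityMeasure ν ∧ MeasInvariant d T ν ∧
      umdim d T ≠ ⊤ ∧
      urdim d T ν = 1 ∧
      Filter.Tendsto (fun t : ℝ => RD d T ν ((2 : ℝ) ^ (-t)) / ENNReal.ofReal t)
        (Filter.atTop ⊓ Filter.principal
          {t : ℝ | ∃ k, 1 ≤ k ∧ (b k : ℝ) ≤ t ∧ t < (a (k + 1) : ℝ)})
        (nhds 0) := by
  haveI : NeZero d := ⟨hd.ne'⟩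
  let J : Set ℕ := {n | ∃ k, 1 ≤ k ∧ a k ≤ n ∧ n < k * a k}
  refine ⟨RDExample.Spc d J, inferInstance, inferInstance, inferInstance, inferInstance,
    RDExample.act J, RDExample.nu d J, RDExample.act_isContAction J, inferInstance,
    RDExample.nu_invariant J, RDExample.umdim_ne_top J,
    le_antisymm (RDExample.urdim_le_one J) (RDExample.one_le_urdim J a ?_ ?_),
    RDExample.decay J a b hab fun n hn => hn⟩
  · intro k hk
    have := hab (k - 1) (by omega)
    rw [Nat.sub_add_cancel (by omega)] at this
    omega
  · intro k hk n h1 h2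
    exact ⟨k, by omega, h1, h2⟩
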